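/- For n ≥ 3 and R = ℤ[t] (or ℤ[t,t⁻¹]), the abelianization of K(R) = ker(SL_n(R) → SL_n(ℤ)) is isomorphic to sl_n(ℤ): H_1(K(R), ℤ) ≅ sl_n(ℤ), an abelian group free of rank n² − 1. -/

import Mathlib

abbrev SLZt (n : ℕ) := Matrix.SpecialLinearGroup (Fin n) (Polynomial ℤ)
abbrev SLL (n : ℕ) := Matrix.SpecialLinearGroup (Fin n) (LaurentPolynomial ℤ)

/-- `K(ℤ[t]) = ker(SL_n(ℤ[t]) → SL_n(ℤ))`, evaluation at `t = 0`. -/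
noncomputable def Kpoly (n : ℕ) : Subgroup (SLZt n) :=
  (Matrix.SpecialLinearGroup.map (Polynomial.evalRingHom (0 : ℤ))).ker

/-- `K(ℤ[t,t⁻¹]) = ker(SL_n(ℤ[t,t⁻¹]) → SL_n(ℤ))`, evaluation at `t = 1`
(realized as reduction mod `(t-1)`). -/
noncomputable def KLauKer (n : ℕ) : Subgroup (SLL n) :=
  (Matrix.SpecialLinearGroup.map
    (Ideal.Quotient.mk (Ideal.span {(LaurentPolynomial.T (1 : ℤ) - 1 : LaurentPolynomial ℤ)}))).ker

/-- `sl_n(ℤ)`, trace-zero integer matrices. -/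
noncomputable def slZ (n : ℕ) : Submodule ℤ (Matrix (Fin n) (Fin n) ℤ) :=
  LinearMap.ker (Matrix.traceLinearMap (Fin n) ℤ ℤ)

namespace SLElem

open Matrix Matrix.SpecialLinearGroup

variable {ι : Type*} [Fintype ι] [DecidableEq ι] {R Q : Type*} [CommRing R] [CommRing Q]

/-- The subgroup generated by the transvections with both indices in `S`. -/
def elem (R : Type*) [CommRing R] (S : Finset ι) : Subgroup (SpecialLinearGroup ι R) :=
  Subgroup.closure {M | ∃ (i j : ι) (h : i ≠ j) (c : R), i ∈ S ∧ j ∈ S ∧ M = transvection h c}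

lemma transvection_mem {S : Finset ι} {i j : ι} (h : i ≠ j) (hi : i ∈ S) (hj : j ∈ S) (c : R) :
    transvection h c ∈ elem R S :=
  Subgroup.subset_closure ⟨i, j, h, c, hi, hj, rfl⟩

lemma transvection_mem_univ {i j : ι} (h : i ≠ j) (c : R) :
    transvection h c ∈ elem R (Finset.univ : Finset ι) :=
  transvection_mem h (Finset.mem_univ _) (Finset.mem_univ _) c

lemma elem_mono {S T : Finset ι} (h : S ⊆ T) : elem R S ≤ elem R T :=
  Subgroup.closure_mono fun _ ⟨i, j, hij, c, hi, hj, e⟩ => ⟨i, j, hij, c, h hi, h hj, e⟩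

lemma map_transvection (f : R →+* Q) {i j : ι} (h : i ≠ j) (c : R) :
    SpecialLinearGroup.map f (transvection h c) = transvection h (f c) := by
  ext a b
  simp [transvection_coe, Matrix.one_apply, Matrix.single_apply, apply_ite f]

lemma map_elem_le (f : R →+* Q) (S : Finset ι) :
    (elem R S).map (SpecialLinearGroup.map f) ≤ elem Q S := by
  rw [elem, MonoidHom.map_closure, Subgroup.closure_le]
  rintro _ ⟨_, ⟨i, j, h, c, hi, hj, rfl⟩, rfl⟩
  rw [map_transvection]
  exact transvection_mem h hi hj _

lemma map_mem_elem (f : R →+* Q) {S : Finset ι} {M : SpecialLinearGroup ι R}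
    (hM : M ∈ elem R S) : SpecialLinearGroup.map f M ∈ elem Q S :=
  map_elem_le f S ⟨M, hM, rfl⟩

lemma exists_lift_elem {f : R →+* Q} (hf : Function.Surjective f) {S : Finset ι}
    {M : SpecialLinearGroup ι Q} (hM : M ∈ elem Q S) :
    ∃ M' ∈ elem R S, SpecialLinearGroup.map f M' = M := by
  suffices elem Q S ≤ (elem R S).map (SpecialLinearGroup.map f) from this hM
  rw [elem, Subgroup.closure_le]
  rintro _ ⟨i, j, h, c, hi, hj, rfl⟩
  obtain ⟨c, rfl⟩ := hf c
  exact ⟨_, transvection_mem h hi hj c, map_transvection f h c⟩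

/-- Matrices that agree with the identity outside of the `S × S` block. -/
def supp (R : Type*) [CommRing R] (S : Finset ι) : Subgroup (SpecialLinearGroup ι R) where
  carrier := {M | ∀ i ∉ S, ∀ j,
    M.1 i j = (1 : Matrix ι ι R) i j ∧ M.1 j i = (1 : Matrix ι ι R) j i}
  one_mem' := fun _ _ _ => ⟨rfl, rfl⟩
  mul_mem' := by
    intro M N hM hN i hi j
    constructor
    · have : ∀ k, M.1 i k * N.1 k j = (1 : Matrix ι ι R) i k * N.1 k j := fun k => by
        rw [(hM i hi k).1]
      rw [coe_mul, Matrix.mul_apply, Finset.sum_congr rfl fun k _ => this k,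
        ← Matrix.mul_apply, Matrix.one_mul, (hN i hi j).1]
    · have : ∀ k, M.1 j k * N.1 k i = M.1 j k * (1 : Matrix ι ι R) k i := fun k => by
        rw [(hN i hi k).2]
      rw [coe_mul, Matrix.mul_apply, Finset.sum_congr rfl fun k _ => this k,
        ← Matrix.mul_apply, Matrix.mul_one, (hM i hi j).2]
  inv_mem' := by
    intro M hM i hi j
    have e1 : M.1 * (M⁻¹).1 = 1 := by rw [← coe_mul, mul_inv_cancel, coe_one]
    have e2 : (M⁻¹).1 * M.1 = 1 := by rw [← coe_mul, inv_mul_cancel, coe_one]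
    constructor
    · have : ∀ k, M.1 i k * (M⁻¹).1 k j = (1 : Matrix ι ι R) i k * (M⁻¹).1 k j := fun k => by
        rw [(hM i hi k).1]
      rw [← e1, Matrix.mul_apply, Finset.sum_congr rfl fun k _ => this k,
        ← Matrix.mul_apply, Matrix.one_mul]
    · have : ∀ k, (M⁻¹).1 j k * M.1 k i = (M⁻¹).1 j k * (1 : Matrix ι ι R) k i := fun k => by
        rw [(hM i hi k).2]
      rw [← e2, Matrix.mul_apply, Finset.sum_congr rfl fun k _ => this k,
        ← Matrix.mul_apply, Matrix.mul_one]

lemma elem_le_supp (S : Finset ι) : elem R S ≤ supp R S := by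
  rw [elem, Subgroup.closure_le]
  rintro _ ⟨i, j, h, c, hi, hj, rfl⟩ a ha b
  have h1 : a ≠ i := fun e => ha (e ▸ hi)
  have h2 : a ≠ j := fun e => ha (e ▸ hj)
  simp [transvection_coe, h1.symm, h2.symm]

/-- `w` is obtained from the row `v` by elementary column operations with indices in `S`. -/
def Red (S : Finset ι) (v w : ι → R) : Prop := ∃ E ∈ elem R S, v ᵥ* E.1 = w

lemma Red.refl (S : Finset ι) (v : ι → R) : Red S v v :=
  ⟨1, one_mem _, by simp⟩

lemma Red.trans {S : Finset ι} {u v w : ι → R} (h1 : Red S u v) (h2 : Red S v w) : Red S u w := by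
  obtain ⟨E, hE, rfl⟩ := h1
  obtain ⟨F, hF, rfl⟩ := h2
  exact ⟨E * F, mul_mem hE hF, by rw [coe_mul, Matrix.vecMul_vecMul]⟩

lemma Red.mono {S T : Finset ι} (h : S ⊆ T) {v w : ι → R} : Red S v w → Red T v w :=
  fun ⟨E, hE, e⟩ => ⟨E, elem_mono h hE, e⟩

lemma Red.eq_of_notMem {S : Finset ι} {v w : ι → R} (h : Red S v w) {j : ι} (hj : j ∉ S) :
    w j = v j := by
  obtain ⟨E, hE, rfl⟩ := h
  have : ∀ k, v k * E.1 k j = v k * (1 : Matrix ι ι R) k j := fun k => by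
    rw [(elem_le_supp S hE j hj k).2]
  have h2 := congrFun (Matrix.vecMul_one v) j
  rw [← h2]
  simp only [Matrix.vecMul, dotProduct] at *
  exact Finset.sum_congr rfl fun k _ => this k

lemma Red.unimodular {S : Finset ι} {v w : ι → R} (h : Red S v w)
    (hv : ∃ u, v ⬝ᵥ u = 1) : ∃ u, w ⬝ᵥ u = 1 := by
  obtain ⟨E, hE, rfl⟩ := h
  obtain ⟨u, hu⟩ := hv
  refine ⟨(E⁻¹).1 *ᵥ u, ?_⟩
  rw [Matrix.dotProduct_mulVec, Matrix.vecMul_vecMul, ← coe_mul, mul_inv_cancel, coe_one,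
    Matrix.vecMul_one, hu]

lemma vecMul_transvection {i j : ι} (h : i ≠ j) (c : R) (v : ι → R) :
    v ᵥ* (transvection h c).1 = Function.update v j (v j + v i * c) := by
  ext k
  rw [transvection_coe, Matrix.vecMul_add, Matrix.vecMul_one]
  rcases eq_or_ne k j with rfl | hk
  · simp [Matrix.vecMul, dotProduct, Matrix.single_apply]
  · simp [Matrix.vecMul, dotProduct, hk, hk.symm]

lemma Red.add {S : Finset ι} {i j : ι} (h : i ≠ j) (hi : i ∈ S) (hj : j ∈ S) (c : R) (v : ι → R) :
    Red S v (Function.update v j (v j + v i * c)) :=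
  ⟨_, transvection_mem h hi hj c, vecMul_transvection h c v⟩

lemma Red.add_sum {S : Finset ι} {l : ι} (hl : l ∈ S) (c : ι → R) (T : Finset ι) (hT : T ⊆ S)
    (hlT : l ∉ T) (v : ι → R) :
    Red S v (Function.update v l (v l + ∑ j ∈ T, v j * c j)) := by
  induction T using Finset.induction_on with
  | empty => simpa using Red.refl S v
  | insert a T ha ih =>
    have hal : a ≠ l := fun e => hlT (e ▸ Finset.mem_insert_self _ _)
    refine (ih (fun x hx => hT (Finset.mem_insert_of_mem hx))
      (fun hx => hlT (Finset.mem_insert_of_mem hx))).trans ?_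
    convert Red.add hal (hT (Finset.mem_insert_self _ _)) hl (c a) _ using 1
    rw [Function.update_idem, Function.update_self, Function.update_of_ne hal,
      Finset.sum_insert ha]
    congr 1; ring

lemma Red.add_all {S : Finset ι} {i : ι} (hi : i ∈ S) (c : ι → R) (T : Finset ι) (hT : T ⊆ S)
    (hiT : i ∉ T) (v : ι → R) :
    Red S v (fun j => if j ∈ T then v j + v i * c j else v j) := by
  induction T using Finset.induction_on with
  | empty => simpa using Red.refl S v
  | insert a T ha ih =>
    have hai : i ≠ a := fun e => hiT (e ▸ Finset.mem_insert_self _ _)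
    have hiT' : i ∉ T := fun hx => hiT (Finset.mem_insert_of_mem hx)
    refine (ih (fun x hx => hT (Finset.mem_insert_of_mem hx)) hiT').trans ?_
    convert Red.add hai hi (hT (Finset.mem_insert_self _ _)) (c a) _ using 1
    ext j
    rcases eq_or_ne j a with rfl | hja
    · simp [ha, hiT']
    · simp [hja]

/-- A unimodular row with a zero entry reduces to a basis vector. -/
lemma Red.single_of_zero {S : Finset ι} {i l : ι} (hi : i ∈ S) (hl : l ∈ S) (hil : i ≠ l)
    {v : ι → R} (hv : ∀ j ∉ S, v j = 0) (hu : ∃ u, v ⬝ᵥ u = 1) (hvl : v l = 0) :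
    Red S v (Pi.single i 1) := by
  obtain ⟨u, hu⟩ := hu
  have h1 := Red.add_sum hl u (S.erase l) (Finset.erase_subset _ _) (Finset.notMem_erase _ _) v
  have hs : ∑ j ∈ S.erase l, v j * u j = 1 := by
    rw [← hu, dotProduct]
    apply Finset.sum_subset (Finset.subset_univ _)
    intro x _ hx
    rcases eq_or_ne x l with rfl | h
    · simp [hvl]
    · simp [hv x (fun hxS => hx (Finset.mem_erase.2 ⟨h, hxS⟩))]
  rw [hs, hvl, zero_add] at h1
  have h2 := h1.trans (Red.add hil.symm hl hi (1 - v i) _)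
  have h3 := h2.trans (Red.add_all hi (fun j => - (Function.update v l 1) j) (S.erase i)
    (Finset.erase_subset _ _) (Finset.notMem_erase _ _) _)
  convert h3 using 1
  ext j
  rcases eq_or_ne j i with rfl | hji
  · simp [hil]
  · by_cases hjS : j ∈ S
    · simp [hji, hjS, hil]
    · have : j ≠ l := fun e => hjS (e ▸ hl)
      simp [hji, hjS, this, hv j hjS]

section Euclid

variable {D : Type*} [EuclideanDomain D]

lemma Red.exists_eq_zero_pair {S : Finset ι} (a b : D) : ∀ (i j : ι), i ≠ j → i ∈ S → j ∈ S →
    ∀ v : ι → D, v i = a → v j = b →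
      ∃ w, Red S v w ∧ w j = 0 ∧ ∀ k, k ≠ i → k ≠ j → w k = v k := by
  classical
  induction a, b using EuclideanDomain.GCD.induction with
  | H0 x =>
    rintro i j hij hi hj v hvi rfl
    refine ⟨_, (Red.add hij.symm hj hi 1 v).trans (Red.add hij hi hj (-1) _), ?_, ?_⟩
    · simp [hvi, hij.symm]
    · intro k hki hkj; simp [hki, hkj]
  | H1 a b ha ih =>
    rintro i j hij hi hj v rfl rfl
    obtain ⟨w, hw, hwi, hwk⟩ := ih j i hij.symm hj hi (Function.update v j (v j % v i))
      (by simp) (by simp [hij])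
    have h1 : Red S v (Function.update v j (v j % v i)) := by
      convert Red.add hij hi hj (-(v j / v i)) v using 2
      rw [EuclideanDomain.mod_eq_sub_mul_div]; ring
    refine ⟨_, (h1.trans hw).trans ((Red.add hij.symm hj hi 1 w).trans (Red.add hij hi hj (-1) _)),
      ?_, ?_⟩
    · simp [hwi, hij.symm]
    · intro k hki hkj; simp [hki, hkj, hwk k hkj hki]

lemma Red.exists_eq_zero {S : Finset ι} {i : ι} (hi : i ∈ S) (v : ι → D) :
    ∃ w, Red S v w ∧ ∀ j ∈ S, j ≠ i → w j = 0 := by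
  suffices ∀ T ⊆ S.erase i, ∃ w, Red S v w ∧ ∀ j ∈ T, w j = 0 by
    obtain ⟨w, hw, h⟩ := this _ subset_rfl
    exact ⟨w, hw, fun j hj hji => h j (Finset.mem_erase.2 ⟨hji, hj⟩)⟩
  intro T
  induction T using Finset.induction_on with
  | empty => exact fun _ => ⟨v, Red.refl S v, by simp⟩
  | insert a T ha ih =>
    intro hT
    obtain ⟨w, hw, h⟩ := ih (fun x hx => hT (Finset.mem_insert_of_mem hx))
    have haS := Finset.mem_erase.1 (hT (Finset.mem_insert_self _ _))
    obtain ⟨w', hw', h0, hk⟩ := Red.exists_eq_zero_pair (S := S) _ _ i a haS.1.symm hi haS.2 w rfl rfl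
    refine ⟨w', hw.trans hw', fun j hj => ?_⟩
    rcases Finset.mem_insert.1 hj with rfl | hj
    · exact h0
    · have hjS := Finset.mem_erase.1 (hT (Finset.mem_insert_of_mem hj))
      rw [hk j hjS.1 (fun e => ha (e ▸ hj)), h j hj]

/-- Rows over a common quotient `Q` of a Euclidean domain `D` and of `R` reduce to one entry. -/
lemma Red.exists_map_eq_zero {φ : D →+* Q} (hφ : Function.Surjective φ) {ψ : R →+* Q}
    (hψ : Function.Surjective ψ) {S : Finset ι} {i : ι} (hi : i ∈ S) (v : ι → R) :
    ∃ w, Red S v w ∧ ∀ j ∈ S, j ≠ i → ψ (w j) = 0 := by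
  choose d hd using fun j => hφ (ψ (v j))
  obtain ⟨w, ⟨E, hE, rfl⟩, hw⟩ := Red.exists_eq_zero hi d
  obtain ⟨F, hF, hFE⟩ := exists_lift_elem hψ (map_mem_elem φ hE)
  refine ⟨_, ⟨F, hF, rfl⟩, fun j hj hji => ?_⟩
  have := congrArg φ (hw j hj hji)
  rw [map_zero] at this
  have hent : ∀ k, ψ (F.1 k j) = φ (E.1 k j) := fun k =>
    congrFun (congrFun (congrArg Subtype.val hFE) k) j
  rw [← this]
  simp only [Matrix.vecMul, dotProduct, map_sum, map_mul, hd, hent]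

end Euclid

/-- If long unimodular rows can be reduced, then it suffices to treat matrices supported on
a block of size `m`. -/
lemma mem_elem_of_supp {m : ℕ} (hm : ∀ T : Finset ι, T.card = m → ∀ M ∈ supp R T,
      M ∈ elem R (Finset.univ : Finset ι))
    (hrow : ∀ S : Finset ι, m < S.card → ∀ i ∈ S, ∀ v : ι → R, (∀ j ∉ S, v j = 0) →
      (∃ u, v ⬝ᵥ u = 1) → Red S v (Pi.single i 1))
    (k : ℕ) : ∀ S : Finset ι, S.card = m + k → ∀ M ∈ supp R S,
      M ∈ elem R (Finset.univ : Finset ι) := by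
  induction k with
  | zero => exact hm
  | succ k ih =>
    intro S hS M hM
    obtain ⟨i, hi⟩ : S.Nonempty := Finset.card_pos.1 (by omega)
    obtain ⟨E, hE, hME⟩ := hrow S (by omega) i hi (M.1 i)
      (fun j hj => by
        rw [(hM j hj i).2, Matrix.one_apply_ne]; rintro rfl; exact hj hi)
      ⟨fun j => (M⁻¹).1 j i, by
        have : M.1 * (M⁻¹).1 = 1 := by rw [← coe_mul, mul_inv_cancel, coe_one]
        simpa [Matrix.mul_apply, dotProduct] using congrFun (congrFun this i) i⟩
    set N := M * E with hN
    have hNi : N.1 i = Pi.single i 1 := by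
      rw [← hME, hN, coe_mul]; ext j; simp [Matrix.mul_apply, Matrix.vecMul, dotProduct]
    have hNS : N ∈ supp R S := mul_mem hM (elem_le_supp S hE)
    have key : ∀ T ⊆ S.erase i, ∃ F ∈ elem R S, (F * N).1 i = Pi.single i 1 ∧
        ∀ j ∈ T, (F * N).1 j i = 0 := by
      intro T
      induction T using Finset.induction_on with
      | empty => exact fun _ => ⟨1, one_mem _, by simpa using hNi, by simp⟩
      | insert a T ha ihT =>
        intro hT
        obtain ⟨F, hF, hFi, hFT⟩ := ihT (fun x hx => hT (Finset.mem_insert_of_mem hx))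
        have haS := Finset.mem_erase.1 (hT (Finset.mem_insert_self _ _))
        refine ⟨transvection haS.1 (-(F * N).1 a i) * F,
          mul_mem (transvection_mem haS.1 haS.2 hi _) hF, ?_, ?_⟩
        · ext j
          rw [mul_assoc, coe_mul, ← hFi]
          exact Matrix.transvection_mul_apply_of_ne a i i j haS.1.symm _ _
        · intro j hj
          rw [mul_assoc, coe_mul]
          rcases eq_or_ne j a with rfl | hja
          · refine (Matrix.transvection_mul_apply_same j i i _ _).trans ?_
            rw [hFi]; simp
          · refine (Matrix.transvection_mul_apply_of_ne a i j i hja _ _).trans ?_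
            exact hFT j ((Finset.mem_insert.1 hj).resolve_left hja)
    obtain ⟨F, hF, hFi, hFT⟩ := key _ subset_rfl
    have hP : F * N ∈ supp R (S.erase i) := by
      intro a ha b
      by_cases haS : a ∈ S
      · obtain rfl : a = i := by
          by_contra hne; exact ha (Finset.mem_erase.2 ⟨hne, haS⟩)
        refine ⟨by rw [hFi, Matrix.one_apply, Pi.single_apply]; simp [eq_comm], ?_⟩
        rcases eq_or_ne b a with rfl | hba
        · rw [hFi]; simp
        · rw [Matrix.one_apply_ne hba]
          by_cases hbS : b ∈ S
          · exact hFT b (Finset.mem_erase.2 ⟨hba, hbS⟩)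
          · rw [(mul_mem (elem_le_supp S hF) hNS b hbS a).1, Matrix.one_apply_ne hba]
      · exact mul_mem (elem_le_supp S hF) hNS a haS b
    have := ih (S.erase i) (by rw [Finset.card_erase_of_mem hi]; omega) _ hP
    have hE' := elem_mono (Finset.subset_univ S) hE
    have hF' := elem_mono (Finset.subset_univ S) hF
    rwa [Subgroup.mul_mem_cancel_left _ hF', hN, Subgroup.mul_mem_cancel_right _ hE'] at this

lemma mem_supp_univ (M : SpecialLinearGroup ι R) : M ∈ supp R (Finset.univ : Finset ι) :=
  fun i hi => absurd (Finset.mem_univ i) hi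

/-- Over a Euclidean domain, the special linear group is generated by transvections. -/
theorem mem_elem_of_euclideanDomain {D : Type*} [EuclideanDomain D] [Nonempty ι]
    (M : SpecialLinearGroup ι D) : M ∈ elem D (Finset.univ : Finset ι) := by
  refine mem_elem_of_supp (m := 1) ?_ ?_ (Fintype.card ι - 1) Finset.univ ?_ M (mem_supp_univ M)
  · intro T hT M hM
    obtain ⟨i, rfl⟩ := Finset.card_eq_one.1 hT
    have hd : M.1 = Matrix.diagonal (fun j => M.1 j j) := by
      ext a b
      by_cases hab : a = b
      · subst hab; simp
      · rw [Matrix.diagonal_apply_ne _ hab]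
        by_cases ha : a = i
        · rw [(hM b (by simp; rintro rfl; exact hab ha) a).2, Matrix.one_apply_ne hab]
        · rw [(hM a (by simpa using ha) b).1, Matrix.one_apply_ne hab]
    have hdet := M.2
    rw [hd, Matrix.det_diagonal, Finset.prod_eq_single i
      (fun j _ hj => by rw [(hM j (by simpa using hj) j).1, Matrix.one_apply_eq])
      (by simp)] at hdet
    have : M = 1 := by
      apply Subtype.ext
      rw [hd, coe_one, ← Matrix.diagonal_one]
      congr 1; ext j
      by_cases hj : j = i
      · rw [hj, hdet]
      · rw [(hM j (by simpa using hj) j).1, Matrix.one_apply_eq]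
    rw [this]; exact one_mem _
  · intro S hS i hi v hv hu
    obtain ⟨w, hw, hw0⟩ := Red.exists_eq_zero hi v
    obtain ⟨l, hl, hli⟩ := Finset.exists_mem_ne hS i
    exact hw.trans (Red.single_of_zero hi hl hli.symm
      (fun j hj => by rw [hw.eq_of_notMem hj, hv j hj]) (hw.unimodular hu) (hw0 l hl hli))
  · rw [Finset.card_univ]; have := Fintype.card_pos (α := ι); omega

end SLElem

namespace SLElem

open Matrix Matrix.SpecialLinearGroup

variable {ι : Type*} [Fintype ι] [DecidableEq ι] {R Q : Type*} [CommRing R] [CommRing Q]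

/-- The matrices underlying the elements of the elementary group. -/
def elemMat (ι : Type*) [Fintype ι] [DecidableEq ι] (R : Type*) [CommRing R] :
    Submonoid (Matrix ι ι R) :=
  (elem R (Finset.univ : Finset ι)).toSubmonoid.map coeMonoidHom

lemma one_add_single_mem {i j : ι} (h : i ≠ j) (c : R) : 1 + single i j c ∈ elemMat ι R :=
  ⟨_, transvection_mem_univ h c, rfl⟩

lemma one_add_vecMulVec_mul {v w v' w' : ι → R} (h : w ⬝ᵥ v' = 0) :
    (1 + vecMulVec v w) * (1 + vecMulVec v' w') = 1 + (vecMulVec v w + vecMulVec v' w') := by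
  rw [mul_add, mul_one, add_mul, one_mul, vecMulVec_mul_vecMulVec, h, zero_smul, vecMulVec_zero,
    add_zero, add_assoc]

lemma one_add_vecMulVec_add_right_mem {v w w' : ι → R} (h : w ⬝ᵥ v = 0)
    (h1 : 1 + vecMulVec v w ∈ elemMat ι R) (h2 : 1 + vecMulVec v w' ∈ elemMat ι R) :
    1 + vecMulVec v (w + w') ∈ elemMat ι R := by
  rw [vecMulVec_add, ← one_add_vecMulVec_mul h]
  exact mul_mem h1 h2

lemma one_add_vecMulVec_add_left_mem {v v' w : ι → R} (h : w ⬝ᵥ v' = 0)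
    (h1 : 1 + vecMulVec v w ∈ elemMat ι R) (h2 : 1 + vecMulVec v' w ∈ elemMat ι R) :
    1 + vecMulVec (v + v') w ∈ elemMat ι R := by
  rw [add_vecMulVec, ← one_add_vecMulVec_mul h]
  exact mul_mem h1 h2

lemma vecMulVec_single_single {κ R : Type*} [DecidableEq κ] [CommRing R] (i j : κ) (a b : R) :
    vecMulVec (Pi.single i a) (Pi.single j b) = single i j (a * b) := by
  ext x y
  simp only [vecMulVec_apply, Matrix.single_apply, Pi.single_apply]
  rcases eq_or_ne x i with rfl | h1 <;> rcases eq_or_ne y j with rfl | h2 <;>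
    simp [*, Ne.symm]

lemma one_add_single_vecMulVec_mem (l : ι) (w : ι → R) (hw : w l = 0) :
    1 + vecMulVec (Pi.single l 1) w ∈ elemMat ι R := by
  suffices ∀ T : Finset ι, l ∉ T →
      1 + vecMulVec (Pi.single l 1) (∑ j ∈ T, Pi.single j (w j)) ∈ elemMat ι R by
    convert this (Finset.univ.erase l) (Finset.notMem_erase _ _)
    rw [← Finset.univ_sum_single w, ← Finset.add_sum_erase _ _ (Finset.mem_univ l)]
    simp [hw, Finset.univ_sum_single]
  intro T
  induction T using Finset.induction_on with
  | empty => simp [one_mem]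
  | insert a T ha ih =>
    intro hl
    have hla : l ≠ a := fun e => hl (e ▸ Finset.mem_insert_self _ _)
    rw [Finset.sum_insert ha]
    refine one_add_vecMulVec_add_right_mem (by simp [hla]) ?_
      (ih fun h => hl (Finset.mem_insert_of_mem h))
    rw [vecMulVec_single_single]
    exact one_add_single_mem hla _

lemma one_add_vecMulVec_single_mem (l : ι) (v : ι → R) (hv : v l = 0) :
    1 + vecMulVec v (Pi.single l 1) ∈ elemMat ι R := by
  suffices ∀ T : Finset ι, l ∉ T →
      1 + vecMulVec (∑ j ∈ T, Pi.single j (v j)) (Pi.single l 1) ∈ elemMat ι R by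
    convert this (Finset.univ.erase l) (Finset.notMem_erase _ _)
    rw [← Finset.univ_sum_single v, ← Finset.add_sum_erase _ _ (Finset.mem_univ l)]
    simp [hv, Finset.univ_sum_single]
  intro T
  induction T using Finset.induction_on with
  | empty => simp [one_mem]
  | insert a T ha ih =>
    intro hl
    have hla : l ≠ a := fun e => hl (e ▸ Finset.mem_insert_self _ _)
    have hlT : l ∉ T := fun h => hl (Finset.mem_insert_of_mem h)
    rw [Finset.sum_insert ha]
    refine one_add_vecMulVec_add_left_mem ?_ ?_ (ih hlT)
    · simp only [single_one_dotProduct, Finset.sum_apply]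
      exact Finset.sum_eq_zero fun j hj => Pi.single_eq_of_ne (by rintro rfl; exact hlT hj) _
    · rw [vecMulVec_single_single]
      exact one_add_single_mem hla.symm _

/-- Suslin's commutator trick. -/
lemma one_add_vecMulVec_mem_of_support {x w : ι → R} (m : ι) (hx : x m = 0) (hw : w m = 0)
    (hwx : w ⬝ᵥ x = 0) : 1 + vecMulVec x w ∈ elemMat ι R := by
  have hX := one_add_vecMulVec_single_mem m x hx
  have hX' := one_add_vecMulVec_single_mem m (-x) (by simp [hx])
  have hY := one_add_single_vecMulVec_mem m w hw
  have hY' := one_add_single_vecMulVec_mem m (-w) (by simp [hw])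
  convert mul_mem (mul_mem (mul_mem hX hY) hX') hY' using 1
  have e1 : (Pi.single m 1 : ι → R) ⬝ᵥ x = 0 := by simp [hx]
  have e2 : w ⬝ᵥ (Pi.single m 1 : ι → R) = 0 := by simp [hw]
  simp only [mul_add, add_mul, mul_one, one_mul, neg_vecMulVec, vecMulVec_neg, mul_neg, neg_mul,
    vecMulVec_mul_vecMulVec, e1, e2, hwx, zero_smul, vecMulVec_zero, add_zero,
    zero_add]
  simp [hwx, hw]
  abel

lemma one_add_vecMulVec_swap_mem (hι : 3 ≤ Fintype.card ι) (v : ι → R) (c : R) (k l : ι) :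
    1 + vecMulVec v (c • (Pi.single k (v l) - Pi.single l (v k))) ∈ elemMat ι R := by
  rcases eq_or_ne k l with rfl | hkl
  · simp [one_mem]
  obtain ⟨m, hm⟩ : ∃ m, m ∉ ({k, l} : Finset ι) := by
    by_contra! h
    have := Finset.card_le_card (Finset.subset_iff.2 fun x (_ : x ∈ Finset.univ) => h x)
    rw [Finset.card_univ, Finset.card_pair hkl] at this
    omega
  simp only [Finset.mem_insert, Finset.mem_singleton, not_or] at hm
  set w : ι → R := c • (Pi.single k (v l) - Pi.single l (v k)) with hw
  set x : ι → R := Pi.single k (v k) + Pi.single l (v l) with hx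
  have hwx : w ⬝ᵥ x = 0 := by
    simp [hw, hx, hkl, hkl.symm]
    ring
  rw [← sub_add_cancel v x]
  refine one_add_vecMulVec_add_left_mem hwx ?_ ?_
  · have hk : (v - x) k = 0 := by simp [hx, hkl]
    have hl : (v - x) l = 0 := by simp [hx, hkl.symm]
    have e : w = (c * v l) • Pi.single k 1 + (-(c * v k)) • Pi.single l 1 := by
      ext a
      simp only [hw, Pi.smul_apply, Pi.sub_apply, Pi.add_apply, Pi.single_apply, smul_eq_mul]
      split_ifs <;> ring
    rw [e]
    refine one_add_vecMulVec_add_right_mem (by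
      rw [smul_dotProduct, single_one_dotProduct, hk, smul_zero]) ?_ ?_
    · rw [vecMulVec_smul, ← smul_vecMulVec]
      exact one_add_vecMulVec_single_mem _ _ (by rw [Pi.smul_apply, hk, smul_zero])
    · rw [vecMulVec_smul, ← smul_vecMulVec]
      exact one_add_vecMulVec_single_mem _ _ (by rw [Pi.smul_apply, hl, smul_zero])
  · exact one_add_vecMulVec_mem_of_support m (by simp [hx, hm.1, hm.2])
      (by simp [hw, hm.1, hm.2]) hwx

lemma one_add_smul_vecMulVec_mem (hι : 3 ≤ Fintype.card ι) (u v w : ι → R) (c : R)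
    (hwv : w ⬝ᵥ v = 0) : 1 + (c * (u ⬝ᵥ v)) • vecMulVec v w ∈ elemMat ι R := by
  have key : ∀ T : Finset (ι × ι), 1 + vecMulVec v (∑ p ∈ T,
      (c * (w p.1 * u p.2)) • (Pi.single p.1 (v p.2) - Pi.single p.2 (v p.1))) ∈ elemMat ι R := by
    intro T
    induction T using Finset.induction_on with
    | empty => simp [one_mem]
    | insert p T hp ih =>
      rw [Finset.sum_insert hp]
      refine one_add_vecMulVec_add_right_mem ?_ (one_add_vecMulVec_swap_mem hι v _ _ _) ih
      simp [mul_comm]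
  convert key Finset.univ using 2
  rw [← vecMulVec_smul]
  congr 1
  ext a
  simp only [Finset.sum_apply, Pi.smul_apply, Pi.sub_apply, Pi.single_apply, smul_eq_mul, mul_sub,
    Fintype.sum_prod_type, Finset.sum_sub_distrib, mul_ite, mul_zero]
  have e1 : ∑ x, ∑ y, (if a = x then c * (w x * u y) * v y else 0) = c * (u ⬝ᵥ v) * w a := by
    simp only [Finset.sum_ite_irrel, Finset.sum_const_zero, Finset.sum_ite_eq, Finset.mem_univ,
      if_true, dotProduct, Finset.mul_sum, Finset.sum_mul]
    exact Finset.sum_congr rfl fun y _ => by ring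
  have e2 : ∑ x, ∑ y, (if a = y then c * (w x * u y) * v x else 0) = 0 := by
    simp only [Finset.sum_ite_eq, Finset.mem_univ, if_true]
    have : ∀ x, c * (w x * u a) * v x = (c * u a) * (w x * v x) := fun x => by ring
    simp only [this, ← Finset.mul_sum]
    rw [show ∑ i, w i * v i = w ⬝ᵥ v from rfl, hwv, mul_zero]
  rw [e1, e2, sub_zero]

variable {B L P : Type*} [CommRing B] [CommRing L] [CommRing P]

lemma coe_conj_transvection (γ : SpecialLinearGroup ι L) {i k : ι} (h : i ≠ k) (c : L) :
    (γ * transvection h c * γ⁻¹).1 =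
      1 + c • vecMulVec (fun x => γ.1 x i) (fun x => (γ⁻¹).1 k x) := by
  have e1 : γ.1 * (γ⁻¹).1 = 1 := by rw [← coe_mul, mul_inv_cancel, coe_one]
  rw [coe_mul, coe_mul, transvection_coe, mul_add, mul_one, add_mul, e1]
  congr 1
  ext a b
  simp [Matrix.mul_apply, Matrix.single_apply, vecMulVec_apply, Finset.sum_ite_eq, ite_and]
  ring

lemma conj_transvection_mem (hι : 3 ≤ Fintype.card ι) {j : B →+* L} (hj : Function.Injective j)
    {ρ : B} {γ : SpecialLinearGroup ι L}
    (h1 : ∀ x y, ∃ b, j b = j ρ * γ.1 x y) (h2 : ∀ x y, ∃ b, j b = j ρ * (γ⁻¹).1 x y)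
    {i k : ι} (h : i ≠ k) (b : B) :
    γ * transvection h (j (ρ ^ 4 * b)) * γ⁻¹ ∈
      (elem B (Finset.univ : Finset ι)).map (SpecialLinearGroup.map j) := by
  choose v hv using fun x => h1 x i
  choose w hw using fun x => h2 k x
  choose u hu using fun x => h2 i x
  have e2 : (γ⁻¹).1 * γ.1 = 1 := by rw [← coe_mul, inv_mul_cancel, coe_one]
  have huv : u ⬝ᵥ v = ρ ^ 2 := hj <| by
    have := congrFun (congrFun e2 i) i
    rw [Matrix.mul_apply, Matrix.one_apply_eq] at this
    simp only [dotProduct, map_sum, map_mul, hu, hv, map_pow]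
    trans j ρ ^ 2 * ∑ y, (γ⁻¹).1 i y * γ.1 y i
    · rw [Finset.mul_sum]
      exact Finset.sum_congr rfl fun y _ => by ring
    · rw [this, mul_one]
  have hwv : w ⬝ᵥ v = 0 := hj <| by
    have := congrFun (congrFun e2 k) i
    rw [Matrix.mul_apply, Matrix.one_apply_ne h.symm] at this
    simp only [dotProduct, map_sum, map_mul, hw, hv, map_zero]
    trans j ρ ^ 2 * ∑ y, (γ⁻¹).1 k y * γ.1 y i
    · rw [Finset.mul_sum]
      exact Finset.sum_congr rfl fun y _ => by ring
    · rw [this, mul_zero]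
  obtain ⟨X, hX, hXe⟩ := one_add_smul_vecMulVec_mem hι u v w b hwv
  refine ⟨X, hX, Subtype.ext ?_⟩
  rw [coe_conj_transvection]
  have : (SpecialLinearGroup.map j X).1 = X.1.map j := rfl
  rw [this, show X.1 = _ from hXe, huv]
  ext x y
  simp only [Matrix.map_apply, Matrix.add_apply, Matrix.smul_apply, vecMulVec_apply, smul_eq_mul,
    map_add, map_mul, map_pow, hv, hw, Matrix.one_apply, apply_ite j, map_one, map_zero]
  ring

/-- Suslin's normality theorem. -/
theorem elem_normal (hι : 3 ≤ Fintype.card ι) :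
    (elem R (Finset.univ : Finset ι)).Normal := by
  refine ⟨fun M hM γ => ?_⟩
  refine (Subgroup.closure_le ((elem R (Finset.univ : Finset ι)).comap
    (MulAut.conj γ).toMonoidHom)).2 ?_ hM
  rintro _ ⟨i, k, h, c, -, -, rfl⟩
  obtain ⟨X, hX, e⟩ := conj_transvection_mem hι (j := RingHom.id R) Function.injective_id (ρ := 1)
    (γ := γ) (fun x y => ⟨γ.1 x y, by simp⟩) (fun x y => ⟨(γ⁻¹).1 x y, by simp⟩) h c
  have e3 : SpecialLinearGroup.map (RingHom.id R) X = X := by ext; rfl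
  rw [e3] at e
  simp only [RingHom.id_apply, one_pow, one_mul] at e
  change γ * transvection h c * γ⁻¹ ∈ elem R (Finset.univ : Finset ι)
  rw [← e]; exact hX

/-- The product of a list of transvections, in the special linear group. -/
def listProd (l : List (TransvectionStruct ι P)) : SpecialLinearGroup ι P :=
  (l.map TransvectionStruct.toSpecialLinearGroup).prod

lemma exists_listProd {M : SpecialLinearGroup ι P} (hM : M ∈ elem P (Finset.univ : Finset ι)) :
    ∃ l, listProd l = M := by
  induction hM using Subgroup.closure_induction with
  | mem x hx =>
    obtain ⟨i, j, h, c, -, -, rfl⟩ := hx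
    exact ⟨[⟨i, j, h, c⟩], by simp [listProd]⟩
  | one => exact ⟨[], rfl⟩
  | mul x y _ _ hx hy =>
    obtain ⟨a, rfl⟩ := hx
    obtain ⟨b, rfl⟩ := hy
    exact ⟨a ++ b, by simp [listProd]⟩
  | inv x _ hx =>
    obtain ⟨a, rfl⟩ := hx
    refine ⟨(a.map TransvectionStruct.inv).reverse, ?_⟩
    simp only [listProd, List.prod_inv_reverse, List.map_reverse, List.map_map]
    congr 3
    ext s x y
    simp only [Function.comp_apply, TransvectionStruct.toSpecialLinearGroup_def, transvection_inv]
    rfl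

lemma exists_denominator {j : B →+* L} {r : B} (σ : P →+* L) (l : List (TransvectionStruct ι P))
    (hl : ∀ s ∈ l, ∃ y, j y = j r * σ s.c) :
    (∀ x y, ∃ b, j b = j (r ^ l.length) * (SpecialLinearGroup.map σ (listProd l)).1 x y) ∧
    ∀ x y, ∃ b, j b = j (r ^ l.length) * ((SpecialLinearGroup.map σ (listProd l))⁻¹).1 x y := by
  induction l using List.reverseRecOn with
  | nil =>
    have (x y : ι) : ∃ b : B, j b = j (r ^ 0) * (1 : Matrix ι ι L) x y :=
      ⟨(1 : Matrix ι ι B) x y, by simp [Matrix.one_apply, apply_ite j]⟩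
    refine ⟨fun x y => ?_, fun x y => ?_⟩
    · simpa [listProd] using this x y
    · rw [listProd, List.map_nil, List.prod_nil, map_one, inv_one]; simpa using this x y
  | append_singleton l s ih =>
    obtain ⟨h1, h2⟩ := ih fun t ht => hl t (List.mem_append_left _ ht)
    obtain ⟨c, hc⟩ := hl s (by simp)
    have e : SpecialLinearGroup.map σ (listProd (l ++ [s])) =
        SpecialLinearGroup.map σ (listProd l) * transvection s.hij (σ s.c) := by
      simp [listProd, TransvectionStruct.toSpecialLinearGroup_def, map_transvection]
    rw [e, _root_.mul_inv_rev, transvection_inv, List.length_append, List.length_singleton]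
    set U := SpecialLinearGroup.map σ (listProd l)
    constructor
    · intro x y
      obtain ⟨b, hb⟩ := h1 x y
      rw [coe_mul]
      rcases eq_or_ne y s.j with rfl | hy
      · obtain ⟨b', hb'⟩ := h1 x s.i
        refine ⟨r * b + c * b', ?_⟩
        refine Eq.trans ?_ (congrArg (j (r ^ (l.length + 1)) * ·)
          (Matrix.mul_transvection_apply_same s.i s.j x (σ s.c) U.1).symm)
        simp only [map_add, map_mul, hb, hb', hc, pow_succ]; ring
      · refine ⟨r * b, ?_⟩
        refine Eq.trans ?_ (congrArg (j (r ^ (l.length + 1)) * ·)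
          (Matrix.mul_transvection_apply_of_ne s.i s.j x y hy (σ s.c) U.1).symm)
        simp only [map_mul, hb, pow_succ]; ring
    · intro x y
      obtain ⟨b, hb⟩ := h2 x y
      rw [coe_mul]
      rcases eq_or_ne x s.i with rfl | hx
      · obtain ⟨b', hb'⟩ := h2 s.j y
        refine ⟨r * b - c * b', ?_⟩
        refine Eq.trans ?_ (congrArg (j (r ^ (l.length + 1)) * ·)
          (Matrix.transvection_mul_apply_same s.i s.j y (-σ s.c) (U⁻¹).1).symm)
        simp only [map_sub, map_mul, hb, hb', hc, pow_succ]; ring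
      · refine ⟨r * b, ?_⟩
        refine Eq.trans ?_ (congrArg (j (r ^ (l.length + 1)) * ·)
          (Matrix.transvection_mul_apply_of_ne s.i s.j x y hx (-σ s.c) (U⁻¹).1).symm)
        simp only [map_mul, hb, pow_succ]; ring

/-- Two specialisations of a product of transvections with bounded denominators which are close
enough differ by an elementary matrix without denominators. -/
lemma exists_patch (hι : 3 ≤ Fintype.card ι) {j : B →+* L} (hj : Function.Injective j) (r : B)
    (l : List (TransvectionStruct ι P)) (σ τ : P →+* L)
    (h1 : ∀ s ∈ l, ∃ y, j y = j r * σ s.c)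
    (h2 : ∀ s ∈ l, ∃ y, j (r ^ (4 * l.length) * y) = σ s.c - τ s.c) :
    SpecialLinearGroup.map σ (listProd l) * (SpecialLinearGroup.map τ (listProd l))⁻¹ ∈
      (elem B (Finset.univ : Finset ι)).map (SpecialLinearGroup.map j) := by
  induction l using List.reverseRecOn with
  | nil => simp [listProd, one_mem]
  | append_singleton l s ih =>
    have h1' : ∀ t ∈ l, ∃ y, j y = j r * σ t.c := fun t ht => h1 t (List.mem_append_left _ ht)
    have ih' := ih h1' fun t ht => by
      obtain ⟨y, hy⟩ := h2 t (List.mem_append_left _ ht)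
      refine ⟨r ^ 4 * y, ?_⟩
      rw [← hy, List.length_append, List.length_singleton]; congr 1; ring
    obtain ⟨y, hy⟩ := h2 s (by simp)
    obtain ⟨d1, d2⟩ := exists_denominator σ l h1'
    have := conj_transvection_mem hι hj d1 d2 s.hij (r ^ 4 * y)
    have e0 : j ((r ^ l.length) ^ 4 * (r ^ 4 * y)) = σ s.c + -τ s.c := by
      rw [← sub_eq_add_neg, ← hy, List.length_append, List.length_singleton]; congr 1; ring
    rw [e0, transvection_add, ← transvection_inv] at this
    have e (φ : P →+* L) : SpecialLinearGroup.map φ (listProd (l ++ [s])) =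
        SpecialLinearGroup.map φ (listProd l) * transvection s.hij (φ s.c) := by
      simp [listProd, TransvectionStruct.toSpecialLinearGroup_def, map_transvection]
    rw [e, e]
    convert mul_mem this ih' using 1
    group

end SLElem

namespace SLElem

open Matrix Matrix.SpecialLinearGroup Polynomial

variable {ι : Type*} [Fintype ι] [DecidableEq ι] {D : Type*} [CommRing D]

/-- Specialisation of a matrix over a polynomial ring at a polynomial. -/
noncomputable def spec (M : SpecialLinearGroup ι D[X]) (a : D[X]) : SpecialLinearGroup ι D[X] :=
  SpecialLinearGroup.map (compRingHom a) M

/-- The ideal of scalars measuring the failure of a matrix to be elementary up to its constant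
term. -/
noncomputable def patchIdeal (M : SpecialLinearGroup ι D[X]) : Ideal D where
  carrier := {s | ∀ a b : D[X], C s ∣ b - a → spec M a * (spec M b)⁻¹ ∈ elem D[X] Finset.univ}
  zero_mem' := by
    intro a b h
    rw [map_zero, zero_dvd_iff, sub_eq_zero] at h
    rw [h, mul_inv_cancel]
    exact one_mem _
  add_mem' := by
    rintro s s' hs hs' a b ⟨x, hx⟩
    have h1 := hs a (a + C s * x) ⟨x, by ring⟩
    have h2 := hs' (a + C s * x) b ⟨x, by
      rw [← sub_sub, hx, map_add]; ring⟩
    convert mul_mem h1 h2 using 1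
    group
  smul_mem' := by
    rintro c s hs a b ⟨x, hx⟩
    exact hs a b ⟨C c * x, by rw [hx, smul_eq_mul, map_mul]; ring⟩

lemma exists_common_denominator {κ D A : Type*} [CommRing D] [CommRing A] [Algebra D A]
    (S : Submonoid D)
    [IsLocalization S A] (l : List (TransvectionStruct κ A[X])) :
    ∃ r ∈ S, ∀ s ∈ l, ∃ y : D[X],
      mapRingHom (algebraMap D A) y = mapRingHom (algebraMap D A) (C r) * s.c := by
  induction l with
  | nil => exact ⟨1, S.one_mem, by simp⟩
  | cons s l ih =>
    obtain ⟨r, hr, h⟩ := ih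
    obtain ⟨b, hbS, hb⟩ := IsLocalization.integerNormalization_spec S s.c
    refine ⟨r * b, S.mul_mem hr hbS, ?_⟩
    intro t ht
    rcases List.mem_cons.1 ht with rfl | ht
    · refine ⟨C r * IsLocalization.integerNormalization S t.c, ?_⟩
      rw [map_mul, coe_mapRingHom, hb, map_mul, Polynomial.map_mul, mul_assoc]
      congr 1
      rw [map_C, algebra_compatible_smul A, smul_eq_C_mul]
    · obtain ⟨y, hy⟩ := h t ht
      refine ⟨C b * y, ?_⟩
      rw [map_mul, hy, map_mul, map_mul]
      ring

lemma exists_notMem_mem_patchIdeal [IsDomain D] (hι : 3 ≤ Fintype.card ι)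
    (M : SpecialLinearGroup ι D[X]) (m : Ideal D) [m.IsPrime]
    (hM : SpecialLinearGroup.map (mapRingHom (algebraMap D (Localization.AtPrime m))) M ∈
      elem (Localization.AtPrime m)[X] Finset.univ) :
    ∃ s ∉ m, s ∈ patchIdeal M := by
  set A := Localization.AtPrime m
  have hφ : Function.Injective (algebraMap D A) :=
    IsLocalization.injective A m.primeCompl_le_nonZeroDivisors
  set j := mapRingHom (algebraMap D A) with hj
  have hji : Function.Injective j := map_injective _ hφ
  obtain ⟨l, hl⟩ := exists_listProd hM
  obtain ⟨r, hr, hrl⟩ := exists_common_denominator m.primeCompl l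
  have hr0 : j (C r) ≠ 0 := by
    rw [Ne, map_eq_zero_iff _ hji, C_eq_zero]
    rintro rfl
    exact hr m.zero_mem
  refine ⟨r ^ (4 * l.length + 1), fun h => hr (‹m.IsPrime›.mem_of_pow_mem _ h), ?_⟩
  intro a b hab
  have hcomp (c y : D[X]) : compRingHom (j c) (j y) = j (compRingHom c y) := by
    simp [hj, Polynomial.map_comp]
  have hspec (c : D[X]) : SpecialLinearGroup.map (compRingHom (j c)) (listProd l) =
      SpecialLinearGroup.map j (spec M c) := by
    rw [hl]
    ext1 x y
    exact (hcomp c (M.1 x y))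
  have hC (c : D[X]) : compRingHom (j c) (j (C r)) = j (C r) := by
    rw [hcomp]; simp
  have hmem := exists_patch hι hji (C r) l (compRingHom (j a)) (compRingHom (j b))
    (fun s hs => by
      obtain ⟨y, hy⟩ := hrl s hs
      exact ⟨compRingHom a y, by rw [← hcomp, hy, map_mul, hC]⟩)
    (fun s hs => by
      obtain ⟨y, hy⟩ := hrl s hs
      have hd : b - a ∣ compRingHom b y - compRingHom a y := by
        have := sub_dvd_eval_sub b a (y.map C)
        simpa [eval_map, Polynomial.comp] using this
      obtain ⟨z, hz⟩ := hab.trans hd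
      refine ⟨-z, mul_left_cancel₀ hr0 ?_⟩
      have e (c : D[X]) : j (C r) * compRingHom (j c) s.c = j (compRingHom c y) := by
        rw [← hcomp, hy, map_mul, hC]
      rw [mul_sub, e, e, ← map_sub, ← map_mul, ← neg_sub, hz]
      congr 1
      rw [map_pow]; ring)
  rw [hspec, hspec, ← map_inv, ← map_mul] at hmem
  obtain ⟨X, hX, e⟩ := hmem
  have : X = spec M a * (spec M b)⁻¹ := by
    ext1 x y
    exact hji (congrFun (congrFun (congrArg Subtype.val e) x) y)
  rwa [← this]

/-- Local-global principle for elementary matrices over a polynomial ring. -/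
theorem mem_elem_of_local [IsDomain D] (hι : 3 ≤ Fintype.card ι) (M : SpecialLinearGroup ι D[X])
    (h0 : SpecialLinearGroup.map (evalRingHom 0) M ∈ elem D Finset.univ)
    (hM : ∀ (m : Ideal D) [m.IsMaximal],
      SpecialLinearGroup.map (mapRingHom (algebraMap D (Localization.AtPrime m))) M ∈
        elem (Localization.AtPrime m)[X] Finset.univ) :
    M ∈ elem D[X] Finset.univ := by
  have h1 : patchIdeal M = ⊤ := by
    by_contra h
    obtain ⟨m, hm, hle⟩ := Ideal.exists_le_maximal _ h
    obtain ⟨s, hs, hs'⟩ := exists_notMem_mem_patchIdeal hι M m (hM m)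
    exact hs (hle hs')
  have h2 := ((Ideal.eq_top_iff_one _).1 h1) X 0 (by simp)
  have e1 : spec M X = M := by
    ext1 x y
    exact (comp_X (p := M.1 x y))
  have e2 : spec M 0 = SpecialLinearGroup.map C (SpecialLinearGroup.map (evalRingHom 0) M) := by
    ext1 x y
    exact (comp_zero (p := M.1 x y))
  rw [e1, e2] at h2
  have := mul_mem h2 (map_mem_elem C h0)
  rwa [inv_mul_cancel_right] at this

end SLElem

namespace SLElem

open Matrix Matrix.SpecialLinearGroup

section Extend

variable {ι κ μ : Type*} [Fintype ι] [DecidableEq ι] [Fintype κ] [DecidableEq κ] [Fintype μ]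
  [DecidableEq μ] {R : Type*} [CommRing R]

/-- The zero-one matrix of an embedding. -/
def embMat (R : Type*) [CommRing R] (e : κ ↪ ι) : Matrix ι κ R :=
  Matrix.of fun x a => if x = e a then 1 else 0

lemma embMat_transpose_mul {ι κ R : Type*} [Fintype ι] [DecidableEq ι] [DecidableEq κ] [CommRing R]
    (e : κ ↪ ι) : (embMat R e)ᵀ * embMat R e = 1 := by
  ext a b
  simp [embMat, Matrix.mul_apply, Matrix.one_apply, eq_comm]

lemma one_add_embMat_mul (e : κ ↪ ι) (M N : Matrix κ κ R) :
    1 + embMat R e * ((M * N - 1) * (embMat R e)ᵀ) =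
      (1 + embMat R e * ((M - 1) * (embMat R e)ᵀ)) *
        (1 + embMat R e * ((N - 1) * (embMat R e)ᵀ)) := by
  have : embMat R e * ((M - 1) * (embMat R e)ᵀ) * (embMat R e * ((N - 1) * (embMat R e)ᵀ)) =
      embMat R e * ((M - 1) * (N - 1) * (embMat R e)ᵀ) := by
    calc _ = embMat R e * ((M - 1) * (((embMat R e)ᵀ * embMat R e) *
          ((N - 1) * (embMat R e)ᵀ))) := by simp only [Matrix.mul_assoc]
      _ = _ := by rw [embMat_transpose_mul, Matrix.one_mul]; simp only [Matrix.mul_assoc]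
  rw [add_mul, mul_add, mul_add, this, one_mul, mul_one, one_mul, add_assoc, ← Matrix.mul_add,
    ← Matrix.mul_add, ← Matrix.add_mul, ← Matrix.add_mul]
  congr 3
  noncomm_ring

/-- Extension of a matrix by the identity along an embedding of the index types. -/
def extend (e : κ ↪ ι) : SpecialLinearGroup κ R →* SpecialLinearGroup ι R where
  toFun M := ⟨1 + embMat R e * ((M.1 - 1) * (embMat R e)ᵀ), by
    rw [det_one_add_mul_comm, Matrix.mul_assoc, embMat_transpose_mul, Matrix.mul_one,
      add_sub_cancel]
    exact M.2⟩
  map_one' := by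
    refine Subtype.ext ?_
    change 1 + embMat R e * ((1 - 1) * (embMat R e)ᵀ) = 1
    simp
  map_mul' M N := Subtype.ext (one_add_embMat_mul e M.1 N.1)

lemma extend_coe (e : κ ↪ ι) (M : SpecialLinearGroup κ R) :
    (extend e M).1 = 1 + embMat R e * ((M.1 - 1) * (embMat R e)ᵀ) := rfl

lemma embMat_mul_mul_apply {ι κ R : Type*} [DecidableEq ι] [Fintype κ] [CommRing R]
    (e : κ ↪ ι) (N : Matrix κ κ R) (x y : ι) :
    (embMat R e * (N * (embMat R e)ᵀ)) x y =
      ∑ a, ∑ b, if x = e a ∧ y = e b then N a b else 0 := by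
  simp only [embMat, Matrix.mul_apply, Matrix.of_apply, transpose_apply, Finset.mul_sum, ite_and]
  refine Finset.sum_congr rfl fun a _ => Finset.sum_congr rfl fun b _ => ?_
  split_ifs <;> simp

lemma extend_transvection (e : κ ↪ ι) {i j : κ} (h : i ≠ j) (c : R) :
    extend e (transvection h c) = transvection (e.injective.ne h) c := by
  refine Subtype.ext ?_
  rw [extend_coe, transvection_coe, transvection_coe, add_sub_cancel_left]
  congr 1
  ext x y
  rw [embMat_mul_mul_apply, Finset.sum_eq_single i, Finset.sum_eq_single j]
  · simp [Matrix.single_apply, eq_comm]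
  · intro b _ hb; simp [hb.symm]
  · simp
  · intro b _ hb
    exact Finset.sum_eq_zero fun y _ => by simp [hb.symm]
  · simp

lemma extend_mem_elem (e : κ ↪ ι) {M : SpecialLinearGroup κ R} (hM : M ∈ elem R Finset.univ) :
    extend e M ∈ elem R (Finset.univ : Finset ι) := by
  suffices elem R (Finset.univ : Finset κ) ≤
      (elem R (Finset.univ : Finset ι)).comap (extend e) from this hM
  refine (Subgroup.closure_le _).2 ?_
  rintro _ ⟨i, j, h, c, -, -, rfl⟩
  change extend e (transvection h c) ∈ elem R Finset.univ
  rw [extend_transvection]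
  exact transvection_mem_univ _ _

lemma extend_trans (e : κ ↪ ι) (e' : ι ↪ μ) (M : SpecialLinearGroup κ R) :
    extend (e.trans e') M = extend e' (extend e M) := by
  have h : embMat R (e.trans e') = embMat R e' * embMat R e := by
    ext x a
    simp [embMat, Matrix.mul_apply]
  refine Subtype.ext ?_
  rw [extend_coe, extend_coe, extend_coe, h, add_sub_cancel_left, transpose_mul]
  simp only [Matrix.mul_assoc]

lemma eq_extend_of_mem_supp (e : κ ↪ ι) {S : Finset ι} (hS : ∀ x ∈ S, x ∈ Set.range e)
    {M : SpecialLinearGroup ι R} (hM : M ∈ supp R S) : ∃ N, M = extend e N := by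
  have key : M.1 = 1 + embMat R e * ((M.1.submatrix e e - 1) * (embMat R e)ᵀ) := by
    ext x y
    rw [Matrix.add_apply, embMat_mul_mul_apply]
    by_cases hx : x ∈ Set.range e ∧ y ∈ Set.range e
    · obtain ⟨⟨a, rfl⟩, ⟨b, rfl⟩⟩ := hx
      rw [Finset.sum_eq_single a, Finset.sum_eq_single b]
      · simp [Matrix.one_apply]
      · intro b' _ hb; simp [hb.symm]
      · simp
      · intro b' _ hb
        exact Finset.sum_eq_zero fun y _ => by simp [hb.symm]
      · simp
    · rw [Finset.sum_eq_zero, add_zero]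
      · by_cases h : x ∈ S
        · exact (hM y (fun h' => hx ⟨hS _ h, hS _ h'⟩) x).2
        · exact (hM x h y).1
      · intro a _
        refine Finset.sum_eq_zero fun b _ => if_neg ?_
        rintro ⟨rfl, rfl⟩
        exact hx ⟨⟨a, rfl⟩, ⟨b, rfl⟩⟩
  have hdet := M.2
  rw [key, det_one_add_mul_comm, Matrix.mul_assoc, embMat_transpose_mul, mul_one,
    add_sub_cancel] at hdet
  exact ⟨⟨_, hdet⟩, Subtype.ext key⟩

end Extend

end SLElem

namespace SLElem

open Matrix Matrix.SpecialLinearGroup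

section Stab

variable {R : Type*} [CommRing R]

/-- The stabilisation map from degree two to degree three. -/
def blk : SpecialLinearGroup (Fin 2) R →* SpecialLinearGroup (Fin 3) R :=
  extend Fin.castSuccEmb

lemma blk_coe (M : SpecialLinearGroup (Fin 2) R) :
    (blk M).1 = !![M.1 0 0, M.1 0 1, 0; M.1 1 0, M.1 1 1, 0; 0, 0, 1] := by
  change 1 + _ = _
  ext i j
  rw [Matrix.add_apply, embMat_mul_mul_apply]
  fin_cases i <;> fin_cases j <;> simp [Fin.sum_univ_two, Matrix.one_apply, Fin.castSucc,
    Fin.castAdd, Fin.castLE]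

lemma blk_mem_elem {M : SpecialLinearGroup (Fin 2) R} (hM : M ∈ elem R Finset.univ) :
    blk M ∈ elem R Finset.univ :=
  extend_mem_elem _ hM

instance : (elem R (Finset.univ : Finset (Fin 3))).Normal := elem_normal (by simp)

/-- The matrix with the given entries. -/
def mkTwo (a b c d : R) (h : a * d - b * c = 1) : SpecialLinearGroup (Fin 2) R :=
  ⟨!![a, b; c, d], by rw [det_fin_two_of, h]⟩

lemma mkTwo_eta (M : SpecialLinearGroup (Fin 2) R) :
    M = mkTwo (M.1 0 0) (M.1 0 1) (M.1 1 0) (M.1 1 1)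
      (by have := M.2; rwa [det_fin_two] at this) :=
  Subtype.ext (eta_fin_two M.1)

lemma transvection_zero_one (c : R) :
    transvection (show (0 : Fin 2) ≠ 1 by decide) c = mkTwo 1 c 0 1 (by ring) := by
  refine Subtype.ext ?_
  rw [transvection_coe]
  ext i j
  fin_cases i <;> fin_cases j <;> simp [mkTwo]

lemma transvection_one_zero (c : R) :
    transvection (show (1 : Fin 2) ≠ 0 by decide) c = mkTwo 1 0 c 1 (by ring) := by
  refine Subtype.ext ?_
  rw [transvection_coe]
  ext i j
  fin_cases i <;> fin_cases j <;> simp [mkTwo]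

lemma mkTwo_mul (a b c d a' b' c' d' : R) (h h') :
    mkTwo a b c d h * mkTwo a' b' c' d' h' =
      mkTwo (a * a' + b * c') (a * b' + b * d') (c * a' + d * c') (c * b' + d * d')
        (by linear_combination (a * d - b * c) * h' + h) := by
  refine Subtype.ext ?_
  change !![a, b; c, d] * !![a', b'; c', d'] = _
  rw [Matrix.mul_fin_two]
  rfl

lemma upper_mem (c : R) : blk (mkTwo 1 c 0 1 (by ring)) ∈ elem R Finset.univ := by
  rw [← transvection_zero_one]
  exact blk_mem_elem (transvection_mem_univ _ _)

lemma lower_mem (c : R) : blk (mkTwo 1 0 c 1 (by ring)) ∈ elem R Finset.univ := by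
  rw [← transvection_one_zero]
  exact blk_mem_elem (transvection_mem_univ _ _)

/-- All matrices with the given first row become elementary in degree three. -/
def Stab (f g : R) : Prop :=
  ∀ h k (e : f * k - g * h = 1), blk (mkTwo f g h k e) ∈ elem R Finset.univ

lemma Stab.of_mem {f g h k : R} {e : f * k - g * h = 1}
    (hM : blk (mkTwo f g h k e) ∈ elem R Finset.univ) : Stab f g := by
  intro h' k' e'
  have : mkTwo f g h' k' e' = mkTwo 1 0 (h' * k - k' * h) 1 (by ring) * mkTwo f g h k e := by
    rw [mkTwo_mul]
    congr 1
    · ring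
    · ring
    · linear_combination (-h') * e + h * e'
    · linear_combination (-k') * e + k * e'
  rw [this, map_mul]
  exact mul_mem (lower_mem _) hM

lemma Stab.add_right {f g : R} (c : R) (H : Stab f (g + f * c)) : Stab f g := by
  intro h k e
  have := H h (k + h * c) (by linear_combination e)
  have e2 : mkTwo f (g + f * c) h (k + h * c) (by linear_combination e) =
      mkTwo f g h k e * mkTwo 1 c 0 1 (by ring) := by
    rw [mkTwo_mul]; congr 1 <;> ring
  rw [e2, map_mul] at this
  exact (Subgroup.mul_mem_cancel_right _ (upper_mem c)).1 this

lemma Stab.add_left {f g : R} (c : R) (H : Stab (f + g * c) g) : Stab f g := by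
  intro h k e
  have := H (h + k * c) k (by linear_combination e)
  have e2 : mkTwo (f + g * c) g (h + k * c) k (by linear_combination e) =
      mkTwo f g h k e * mkTwo 1 0 c 1 (by ring) := by
    rw [mkTwo_mul]; congr 1 <;> ring
  rw [e2, map_mul] at this
  exact (Subgroup.mul_mem_cancel_right _ (lower_mem c)).1 this

lemma Stab.add_row {f g h k : R} (e : f * k - g * h = 1) (H : Stab (f + h) (g + k)) :
    Stab f g := by
  have := H h k (by linear_combination e)
  have e2 : mkTwo (f + h) (g + k) h k (by linear_combination e) =
      mkTwo 1 1 0 1 (by ring) * mkTwo f g h k e := by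
    rw [mkTwo_mul]; congr 1 <;> ring
  rw [e2, map_mul] at this
  exact Stab.of_mem ((Subgroup.mul_mem_cancel_left _ (upper_mem 1)).1 this)

lemma Stab.one_zero : Stab (1 : R) 0 := by
  refine Stab.of_mem (h := 0) (k := 1) (e := by ring) (lower_mem 0)

lemma Stab.one_left (g : R) : Stab 1 g := by
  refine Stab.add_right (-g) ?_
  rw [one_mul, add_neg_cancel]
  exact Stab.one_zero

lemma Stab.of_isUnit_right {g : R} (hg : IsUnit g) (f : R) : Stab f g := by
  obtain ⟨u, hu⟩ := hg.exists_right_inv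
  refine Stab.add_left (u * (1 - f)) ?_
  rw [← mul_assoc, hu, one_mul, add_sub_cancel]
  exact Stab.one_left g

lemma Stab.of_isUnit_left {f : R} (hf : IsUnit f) (g : R) : Stab f g := by
  obtain ⟨u, hu⟩ := hf.exists_right_inv
  refine Stab.add_right (u * (1 - g)) ?_
  rw [← mul_assoc, hu, one_mul, add_sub_cancel]
  exact Stab.of_isUnit_right isUnit_one _

lemma Stab.swap {f g : R} (H : Stab g (-f)) : Stab f g := by
  refine Stab.add_right (-1) (Stab.add_left 1 (Stab.add_right (-1) ?_))
  convert H using 1 <;> ring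

/-- A diagonal sign matrix. -/
def signMat : SpecialLinearGroup (Fin 3) R :=
  ⟨!![1, 0, 0; 0, -1, 0; 0, 0, -1], by simp [det_fin_three]⟩

/-- A cyclic permutation matrix. -/
def cycMat : SpecialLinearGroup (Fin 3) R :=
  ⟨!![0, 0, 1; 1, 0, 0; 0, 1, 0], by simp [det_fin_three]⟩

lemma Stab.neg_right {f g : R} (H : Stab f (-g)) : Stab f g := by
  intro h k e
  have e1 : f * k - (-g) * (-h) = 1 := by linear_combination e
  have key : signMat * blk (mkTwo f (-g) (-h) k e1) = blk (mkTwo f g h k e) * signMat := by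
    refine Subtype.ext ?_
    rw [coe_mul, coe_mul, blk_coe, blk_coe]
    simp [signMat, mkTwo]
  have h2 : signMat * blk (mkTwo f (-g) (-h) k e1) * signMat⁻¹ ∈ elem R Finset.univ :=
    Subgroup.Normal.conj_mem inferInstance _ (H _ _ e1) _
  rwa [key, mul_inv_cancel_right] at h2

lemma Stab.symm {f g : R} (H : Stab g f) : Stab f g :=
  Stab.swap (Stab.neg_right (by rwa [neg_neg]))

lemma transvection_two_zero (x : R) : (transvection (show (2 : Fin 3) ≠ 0 by decide) x).1 =
    !![1, 0, 0; 0, 1, 0; x, 0, 1] := by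
  rw [transvection_coe]
  ext i j
  fin_cases i <;> fin_cases j <;> simp

lemma transvection_two_one (x : R) : (transvection (show (2 : Fin 3) ≠ 1 by decide) x).1 =
    !![1, 0, 0; 0, 1, 0; 0, x, 1] := by
  rw [transvection_coe]
  ext i j
  fin_cases i <;> fin_cases j <;> simp

lemma transvection_zero_two (x : R) : (transvection (show (0 : Fin 3) ≠ 2 by decide) x).1 =
    !![1, 0, x; 0, 1, 0; 0, 0, 1] := by
  rw [transvection_coe]
  ext i j
  fin_cases i <;> fin_cases j <;> simp

lemma blk_identity (a b b' c d : R) (e : a * d - b * (b' * c) = 1) :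
    !![1, 0, 0; 0, 0, 1; 0, -1, 0] * !![1, 0, 0; 0, 1, 0; d * c, 0, 1] *
      !![1, 0, 0; 0, 1, 0; 0, -(b * c), 1] *
      (!![a, b, 0; b' * c, d, 0; 0, 0, 1] * !![1, 0, 0; 0, b', -a; 0, d, -(b * c)]) *
      (!![1, 0, b; 0, 1, 0; 0, 0, 1] * !![1, 0, 0; 0, 1, 0; b' * c, 0, 1] *
      !![1, 0, 0; 0, 1, 0; 0, d * b', 1]) = !![a, b * b', 0; c, d, 0; 0, 0, 1] := by
  simp only [Matrix.mul_fin_three]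
  ext i j
  fin_cases i <;> fin_cases j <;> simp <;> grind

lemma blk_mkTwo_mem_iff (a b b' c d : R) (e : a * d - b * (b' * c) = 1)
    (h1 : blk (mkTwo a b (b' * c) d e) ∈ elem R Finset.univ) :
    blk (mkTwo a b' (b * c) d (by linear_combination e)) ∈ elem R Finset.univ ↔
      blk (mkTwo a (b * b') c d (by linear_combination e)) ∈ elem R Finset.univ := by
  set M := mkTwo a b' (b * c) d (by linear_combination e) with hM
  set M' := mkTwo a (b * b') c d (by linear_combination e) with hM'
  have hw : blk (mkTwo 0 (-1) 1 0 (by ring) : SpecialLinearGroup (Fin 2) R) ∈ elem R Finset.univ :=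
    Stab.of_isUnit_right isUnit_one.neg 0 _ _ _
  have hw' : blk (mkTwo 0 1 (-1) 0 (by ring) : SpecialLinearGroup (Fin 2) R) ∈ elem R Finset.univ :=
    Stab.of_isUnit_right isUnit_one 0 _ _ _
  have hcyc {Y Z : SpecialLinearGroup (Fin 3) R} (h : Y * cycMat = cycMat * Z) :
      Z ∈ elem R Finset.univ ↔ Y ∈ elem R Finset.univ := by
    rw [eq_mul_inv_of_mul_eq h, Subgroup.Normal.mem_comm_iff inferInstance, inv_mul_cancel_left]
  set N : SpecialLinearGroup (Fin 3) R := ⟨!![1, 0, 0; 0, b', -a; 0, d, -(b * c)], by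
    simp [det_fin_three]; linear_combination e⟩ with hN
  set W : SpecialLinearGroup (Fin 3) R := ⟨!![1, 0, 0; 0, 0, 1; 0, -1, 0], by
    simp [det_fin_three]⟩ with hW
  have hNM : N ∈ elem R Finset.univ ↔ blk M ∈ elem R Finset.univ := by
    rw [← hcyc (Z := blk (M * mkTwo 0 (-1) 1 0 (by ring))), map_mul, Subgroup.mul_mem_cancel_right _ hw]
    refine Subtype.ext ?_
    rw [coe_mul, coe_mul, hM, mkTwo_mul, blk_coe]
    simp [cycMat, mkTwo, N]
  have hWm : W ∈ elem R Finset.univ := by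
    rw [← hcyc (Z := blk (mkTwo 0 1 (-1) 0 (by ring)))]
    · exact hw'
    refine Subtype.ext ?_
    rw [coe_mul, coe_mul, blk_coe]
    simp [cycMat, mkTwo, W]
  have key : W * transvection (show (2 : Fin 3) ≠ 0 by decide) (d * c) *
      transvection (show (2 : Fin 3) ≠ 1 by decide) (-(b * c)) *
      (blk (mkTwo a b (b' * c) d e) * N) * (transvection (show (0 : Fin 3) ≠ 2 by decide) b *
      transvection (show (2 : Fin 3) ≠ 0 by decide) (b' * c) *
      transvection (show (2 : Fin 3) ≠ 1 by decide) (d * b')) = blk M' := by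
    refine Subtype.ext ?_
    rw [blk_coe]
    simp only [coe_mul, transvection_two_zero, transvection_two_one, transvection_zero_two, blk_coe]
    exact blk_identity a b b' c d e
  have t1 (i j : Fin 3) (h : i ≠ j) (x : R) := transvection_mem_univ h x
  rw [← key, ← hNM, Subgroup.mul_mem_cancel_right _ (mul_mem (mul_mem (t1 _ _ _ _) (t1 _ _ _ _))
    (t1 _ _ _ _)), Subgroup.mul_mem_cancel_left _ (mul_mem (mul_mem hWm (t1 _ _ _ _))
    (t1 _ _ _ _)), Subgroup.mul_mem_cancel_left _ h1]

lemma Stab.mul_right {a b b' : R} (H : Stab a b) (H' : Stab a b') : Stab a (b * b') := by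
  intro c d e
  exact (blk_mkTwo_mem_iff a b b' c d (by linear_combination e) (H _ _ _)).1 (H' _ _ _)

lemma Stab.of_mul_right {a b b' : R} (hab : IsCoprime a b) (H : Stab a b) (H' : Stab a (b * b')) :
    Stab a b' := by
  by_cases hab' : IsCoprime a b'
  · obtain ⟨d, c, e⟩ := hab.mul_right hab'
    have e1 : a * d - b * (b' * -c) = 1 := by linear_combination e
    exact Stab.of_mem ((blk_mkTwo_mem_iff a b b' (-c) d e1 (H _ _ _)).2 (H' _ _ _))
  · intro h k e
    exact absurd ⟨k, -h, by linear_combination e⟩ hab'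

lemma Stab.pow_right {a b : R} (H : Stab a b) (n : ℕ) : Stab a (b ^ n) := by
  induction n with
  | zero => rw [pow_zero]; exact Stab.of_isUnit_right isUnit_one a
  | succ n ih => rw [pow_succ]; exact ih.mul_right H

end Stab

end SLElem

namespace SLElem

open Polynomial

section Local

variable {A : Type*} [CommRing A]

lemma degree_le_of_lt_succ {p : A[X]} {d : ℕ} (h : p.degree < (d + 1 : ℕ)) : p.degree ≤ d :=
  degree_le_of_natDegree_le <| natDegree_le_iff_coeff_eq_zero.2 fun m hm =>
    (degree_lt_iff_coeff_zero _ _).1 h m hm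

lemma Stab.X_left {g : A[X]} (hg : IsUnit (g.coeff 0)) : Stab X g := by
  refine Stab.add_right (-g.divX) ?_
  have : g + X * -g.divX = C (g.coeff 0) := by
    linear_combination -(X_mul_divX_add g)
  rw [this]
  exact Stab.of_isUnit_right (isUnit_C.2 hg) _

lemma Stab.of_monic_of_coeff_zero [Nontrivial A] {d : ℕ} (ih : ∀ f : A[X], f.Monic → f.natDegree = d →
    ∀ g, Stab f g) {f g : A[X]} (hf : f.Monic) (hd : f.natDegree = d + 1)
    (hg : g.degree < f.degree) (h0 : IsUnit (g.coeff 0)) : Stab f g := by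
  obtain ⟨u, hu⟩ := h0.exists_right_inv
  refine Stab.add_left (-C (u * f.coeff 0)) ?_
  have hdeg : (g * -C (u * f.coeff 0)).degree < f.degree := by
    refine lt_of_le_of_lt (degree_mul_le _ _) ?_
    rw [degree_neg]
    calc g.degree + (C (u * f.coeff 0)).degree ≤ g.degree + 0 := by gcongr; exact degree_C_le
      _ < f.degree := by rwa [add_zero]
  have hm : (f + g * -C (u * f.coeff 0)).Monic := hf.add_of_left hdeg
  have hX : X ∣ f + g * -C (u * f.coeff 0) := by
    rw [X_dvd_iff, ← C_neg, coeff_add, coeff_mul_C]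
    linear_combination -f.coeff 0 * hu
  have hnd : (f + g * -C (u * f.coeff 0)).natDegree = d + 1 := by
    rw [natDegree_eq_of_degree_eq (degree_add_eq_left_of_degree_lt hdeg), hd]
  obtain ⟨f', hf'⟩ := hX
  rw [hf'] at hm hnd ⊢
  have hm' : f'.Monic := monic_X.of_mul_monic_left hm
  rw [monic_X.natDegree_mul hm', natDegree_X] at hnd
  exact (((Stab.X_left h0).symm).mul_right (ih f' hm' (by omega) g).symm).symm

lemma Stab.of_monic [IsLocalRing A] {f : A[X]} (hf : f.Monic) (g : A[X]) : Stab f g := by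
  induction hd : f.natDegree generalizing f g with
  | zero =>
    rw [hf.natDegree_eq_zero.1 hd]
    exact Stab.one_left g
  | succ d ih =>
    replace ih : ∀ f : A[X], f.Monic → f.natDegree = d → ∀ g, Stab f g := fun f h h' g => ih h g h'
    have hfd : f.degree = (d + 1 : ℕ) := by rw [degree_eq_natDegree hf.ne_zero, hd]
    refine Stab.add_right (-(g /ₘ f)) ?_
    have : g + f * -(g /ₘ f) = g %ₘ f := by linear_combination -(modByMonic_add_div g f)
    rw [this]
    have hg := degree_modByMonic_lt g hf
    set g' := g %ₘ f
    clear_value g'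
    intro h₀ k₀ e₀
    suffices Stab f g' from this _ _ _
    set h := h₀ %ₘ f
    have hh : h.degree < f.degree := degree_modByMonic_lt h₀ hf
    set k := k₀ - g' * (h₀ /ₘ f)
    have e : f * k - g' * h = 1 := by
      linear_combination e₀ - g' * (modByMonic_add_div h₀ f)
    have hk : k.degree < f.degree := by
      by_contra! hk
      have hk0 : k ≠ 0 := by rintro h0; rw [h0, hfd] at hk; simp at hk
      have hkd : d + 1 ≤ k.natDegree := by
        rw [hfd, degree_eq_natDegree hk0] at hk; exact_mod_cast hk
      have h1 : (f * k).degree = ((d + 1 + k.natDegree : ℕ) : WithBot ℕ) := by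
        rw [degree_eq_natDegree (by rwa [Ne, hf.mul_right_eq_zero_iff]), hf.natDegree_mul' hk0, hd]
      have : f * k = 1 + g' * h := by linear_combination e
      rw [this] at h1
      refine h1.not_lt (lt_of_le_of_lt (degree_add_le _ _) (max_lt ?_ ?_))
      · refine lt_of_le_of_lt degree_one_le ?_
        exact_mod_cast (by omega : 0 < d + 1 + k.natDegree)
      · refine lt_of_le_of_lt (degree_mul_le _ _) ?_
        have h2 : g'.degree + h.degree ≤ (d : WithBot ℕ) + d :=
          add_le_add (degree_le_of_lt_succ (hfd ▸ hg)) (degree_le_of_lt_succ (hfd ▸ hh))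
        refine h2.trans_lt ?_
        exact_mod_cast (by omega : d + d < d + 1 + k.natDegree)
    have e0 : f.coeff 0 * k.coeff 0 - g'.coeff 0 * h.coeff 0 = 1 := by
      rw [← mul_coeff_zero, ← mul_coeff_zero, ← coeff_sub, e, coeff_one_zero]
    by_cases hu : IsUnit (g'.coeff 0)
    · exact Stab.of_monic_of_coeff_zero ih hf hd hg hu
    · refine Stab.add_row e (Stab.of_monic_of_coeff_zero ih (hf.add_of_left hh) ?_ ?_ ?_)
      · rw [natDegree_eq_of_degree_eq (degree_add_eq_left_of_degree_lt hh), hd]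
      · rw [degree_add_eq_left_of_degree_lt hh]
        exact lt_of_le_of_lt (degree_add_le _ _) (max_lt hg hk)
      · have hk0 : IsUnit (k.coeff 0) := by
          by_contra hk0
          have : (1 : A) ∈ IsLocalRing.maximalIdeal A := by
            rw [← e0]
            exact sub_mem (Ideal.mul_mem_left _ _ hk0) (Ideal.mul_mem_right _ _ hu)
          exact this isUnit_one
        by_contra hgk
        rw [coeff_add] at hgk
        have : k.coeff 0 ∈ IsLocalRing.maximalIdeal A := by
          rw [← add_sub_cancel_left (g'.coeff 0) (k.coeff 0)]
          exact sub_mem hgk hu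
        exact this hk0

lemma Stab.of_isUnit_leadingCoeff [IsLocalRing A] {f : A[X]} (hf : IsUnit f.leadingCoeff)
    (g : A[X]) : Stab f g := by
  obtain ⟨u, hu⟩ := hf.exists_right_inv
  have hm : (C u * f).Monic := by
    rwa [Monic, leadingCoeff_C_mul_of_isUnit, mul_comm]
    exact .of_mul_eq_one _ ((mul_comm _ _).trans hu)
  have : f = C f.leadingCoeff * (C u * f) := by
    rw [← mul_assoc, ← C_mul, hu, C_1, one_mul]
  rw [this]
  exact ((Stab.of_isUnit_right (isUnit_C.2 hf) g).mul_right (Stab.of_monic hm g).symm).symm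

/-- Nakayama's lemma modulo a monic polynomial. -/
lemma exists_eq_add_monic_mul [IsLocalRing A] {ϖ : A} (hϖ : ϖ ∈ IsLocalRing.maximalIdeal A)
    {P : A[X]} (hP : P.Monic) (N : Submodule A A[X])
    (h : ∀ p, ∃ a ∈ N, ∃ y z, p = a + P * y + C ϖ * z) (p : A[X]) :
    ∃ a ∈ N, ∃ y, p = a + P * y := by
  let π : A[X] →ₗ[A] A[X] ⧸ Ideal.span {P} := (Ideal.Quotient.mkₐ A _).toLinearMap
  have hfin : Module.Finite A (A[X] ⧸ Ideal.span {P}) := hP.finite_quotient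
  have hπ (p q : A[X]) : π p = π q ↔ P ∣ p - q := by
    rw [← Ideal.mem_span_singleton, ← Ideal.Quotient.eq]; rfl
  have key : (⊤ : Submodule A (A[X] ⧸ Ideal.span {P})) ≤ N.map π := by
    refine Submodule.le_of_le_smul_of_le_jacobson_bot (I := IsLocalRing.maximalIdeal A)
      hfin.1 (IsLocalRing.jacobson_eq_maximalIdeal _ bot_ne_top).ge ?_
    intro x _
    obtain ⟨p, rfl⟩ := Ideal.Quotient.mk_surjective x
    obtain ⟨a, ha, y, z, e⟩ := h p
    have : Ideal.Quotient.mk (Ideal.span {P}) p = π a + ϖ • π z := by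
      rw [← map_smul, ← map_add]
      refine (hπ p _).2 ⟨y, ?_⟩
      rw [e, smul_eq_C_mul]; ring
    rw [this]
    exact Submodule.add_mem_sup (Submodule.mem_map_of_mem ha)
      (Submodule.smul_mem_smul hϖ Submodule.mem_top)
  obtain ⟨a, ha, e⟩ := key (Submodule.mem_top (x := π p))
  obtain ⟨y, hy⟩ := (hπ p a).1 e.symm
  exact ⟨a, ha, y, by rw [← hy]; ring⟩

end Local

end SLElem

namespace SLElem

open Polynomial

section DVR

variable {A : Type*} [CommRing A]

lemma reflect_reflect (N : ℕ) (f : A[X]) : reflect N (reflect N f) = f := by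
  ext i
  rw [coeff_reflect, coeff_reflect, revAt_invol]

lemma natDegree_reflect_le_of_le {N : ℕ} {f : A[X]} (h : f.natDegree ≤ N) :
    (reflect N f).natDegree ≤ N :=
  natDegree_reflect_le.trans (max_le le_rfl h)

lemma isCoprime_X_pow {U : A[X]} (hU : IsUnit (U.coeff 0)) (d : ℕ) : IsCoprime U (X ^ d) := by
  refine IsCoprime.pow_right ?_
  obtain ⟨u, hu⟩ := hU.exists_right_inv
  refine ⟨C u, -(C u * U.divX), ?_⟩
  have : C (U.coeff 0) * C u = 1 := by rw [← C_mul, hu, C_1]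
  linear_combination this - C u * (X_mul_divX_add U)

lemma Stab.of_low_degree (f : A[X]) (hc : IsCoprime f (C f.leadingCoeff))
    (hs : Stab f (C f.leadingCoeff)) (H : ∀ g : A[X], g.degree < f.degree → Stab f g)
    (g : A[X]) : Stab f g := by
  suffices ∀ n : ℕ, ∀ g : A[X], g.degree < n → Stab f g from
    this (g.natDegree + 1) g (degree_le_natDegree.trans_lt (by exact_mod_cast Nat.lt_succ_self _))
  intro n
  induction n with
  | zero =>
    intro g hg
    by_cases hf : f = 0
    · have : IsUnit (0 : A[X]) := by simpa [hf, isCoprime_zero_left] using hc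
      exact Stab.of_isUnit_left (hf ▸ this) g
    · have : g = 0 := by
        rw [← degree_eq_bot]; exact Nat.WithBot.lt_zero_iff.1 hg
      exact H g (by rw [this, degree_zero]; exact bot_lt_iff_ne_bot.2 (by simpa using hf))
  | succ n ih =>
    intro g hg
    by_cases hgf : g.degree < f.degree
    · exact H g hgf
    have hfn : f.natDegree ≤ n := by
      refine natDegree_le_of_degree_le ((not_lt.1 hgf).trans ?_)
      exact degree_le_of_lt_succ hg
    refine Stab.of_mul_right hc hs (Stab.add_right (-(C (g.coeff n) * X ^ (n - f.natDegree)))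
      (ih _ ?_))
    rw [degree_lt_iff_coeff_zero] at hg ⊢
    intro m hm
    have : C f.leadingCoeff * g + f * -(C (g.coeff n) * X ^ (n - f.natDegree)) =
      C f.leadingCoeff * g - C (g.coeff n) * (f * X ^ (n - f.natDegree)) := by ring
    rw [this, coeff_sub, coeff_C_mul, coeff_C_mul, coeff_mul_X_pow', if_pos (by omega)]
    rcases hm.eq_or_lt with rfl | hm
    · rw [Nat.sub_sub_self hfn, leadingCoeff, mul_comm, sub_self]
    · rw [hg m (by omega), coeff_eq_zero_of_natDegree_lt (p := f) (by omega), mul_zero,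
        mul_zero, sub_zero]

variable [IsDomain A] [IsDiscreteValuationRing A] {ϖ : A}

lemma isUnit_iff_not_dvd (hϖ : Irreducible ϖ) (a : A) : IsUnit a ↔ ¬ ϖ ∣ a := by
  rw [← Ideal.mem_span_singleton, ← hϖ.maximalIdeal_eq, IsLocalRing.mem_maximalIdeal, mem_nonunits_iff,
    not_not]

lemma isCoprime_C {f : A[X]} (hϖ : Irreducible ϖ) (hf : C ϖ ∣ f - 1) {a : A} (ha : a ≠ 0) :
    IsCoprime f (C a) := by
  obtain ⟨n, u, rfl⟩ := IsDiscreteValuationRing.eq_unit_mul_pow_irreducible ha hϖ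
  obtain ⟨x, hx⟩ := hf
  rw [C_mul, C_pow]
  refine IsCoprime.mul_right ?_ (IsCoprime.pow_right ⟨1, -x, by linear_combination hx⟩)
  exact ⟨0, C ↑u⁻¹, by rw [← C_mul, Units.inv_mul, C_1]; ring⟩

lemma Stab.C_right {f : A[X]} (hϖ : Irreducible ϖ) (hf : C ϖ ∣ f - 1) {a : A} (ha : a ≠ 0) :
    Stab f (C a) := by
  obtain ⟨n, u, rfl⟩ := IsDiscreteValuationRing.eq_unit_mul_pow_irreducible ha hϖ
  obtain ⟨x, hx⟩ := hf
  rw [C_mul, C_pow]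
  refine (Stab.of_isUnit_right (isUnit_C.2 u.isUnit) f).mul_right (Stab.pow_right ?_ n)
  refine Stab.add_left (-x) ?_
  rw [show f + C ϖ * -x = 1 by linear_combination hx]
  exact Stab.one_left _

lemma isCoprime_of_isUnit_leadingCoeff {f Q : A[X]} (hϖ : Irreducible ϖ) (hf : C ϖ ∣ f - 1)
    (hQ : IsUnit Q.leadingCoeff) : IsCoprime f Q := by
  obtain ⟨x, hx⟩ := hf
  obtain ⟨u, hu⟩ := hQ.exists_right_inv
  have hm : (C u * Q).Monic := by
    rwa [Monic, leadingCoeff_C_mul_of_isUnit, mul_comm]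
    exact .of_mul_eq_one _ ((mul_comm _ _).trans hu)
  obtain ⟨_, ⟨y, rfl⟩, z, e⟩ := exists_eq_add_monic_mul (ϖ := ϖ)
    (by rw [hϖ.maximalIdeal_eq]; exact Ideal.mem_span_singleton_self ϖ) hm
    (LinearMap.range (LinearMap.mulLeft A f))
    (fun p => ⟨_, ⟨p, rfl⟩, 0, -(x * p), by
      rw [LinearMap.mulLeft_apply]; linear_combination -(p * hx)⟩) 1
  rw [LinearMap.mulLeft_apply] at e
  exact ⟨y, C u * z, by linear_combination -e⟩

/-- If some coefficient of `F` is a unit, then modulo `ϖ` the polynomial `F` is a power of `X`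
times a polynomial with unit constant coefficient. -/
lemma exists_eq_C_mul_add_X_pow_mul (hϖ : Irreducible ϖ) {F : A[X]} (hF : ¬ C ϖ ∣ F) :
    ∃ e Z U, F = C ϖ * Z + X ^ e * U ∧ IsUnit (U.coeff 0) ∧ IsUnit (F.coeff e) := by
  classical
  simp only [C_dvd_iff_dvd_coeff, not_forall] at hF
  set e := Nat.find hF with he
  have h1 : C ϖ ∣ ∑ i ∈ Finset.range e, C (F.coeff i) * X ^ i := by
    refine Finset.dvd_sum fun i hi => Dvd.dvd.mul_right ?_ _
    exact map_dvd C (not_not.1 (Nat.find_min hF (Finset.mem_range.1 hi)))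
  have h2 (m : ℕ) : (∑ i ∈ Finset.range e, C (F.coeff i) * X ^ i).coeff m =
      if m < e then F.coeff m else 0 := by
    simp [coeff_X_pow]
  have h3 : X ^ e ∣ F - ∑ i ∈ Finset.range e, C (F.coeff i) * X ^ i := by
    rw [X_pow_dvd_iff]
    intro m hm
    rw [coeff_sub, h2, if_pos hm, sub_self]
  have h4 : IsUnit (F.coeff e) := (isUnit_iff_not_dvd hϖ _).2 (Nat.find_spec hF)
  obtain ⟨Z, hZ⟩ := h1
  obtain ⟨U, hU⟩ := h3
  refine ⟨e, Z, U, by linear_combination hU + hZ, ?_, h4⟩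
  have := congrArg (fun p => p.coeff e) hU
  simp only [coeff_sub, h2, lt_irrefl, if_false, sub_zero] at this
  rw [mul_comm, coeff_mul_X_pow', if_pos le_rfl, Nat.sub_self] at this
  rwa [← this]

lemma exists_X_pow_eq (hϖ : Irreducible ϖ) {F P : A[X]} {d e : ℕ} {Z U : A[X]} (he : e < d)
    (hF : F = C ϖ * Z + X ^ e * U) (hU : IsUnit (U.coeff 0)) (hP : P.Monic)
    (hPX : C ϖ ∣ P - X ^ d) :
    ∃ r q z, X ^ e - r = F * q + P * z ∧ r.degree < (e : WithBot ℕ) ∧ C ϖ ∣ r ∧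
      IsUnit (q.coeff 0) := by
  obtain ⟨x, hx⟩ := hPX
  obtain ⟨a, b, hab⟩ := isCoprime_X_pow hU d
  obtain ⟨s, hs, y, e1⟩ := exists_eq_add_monic_mul (ϖ := ϖ)
    (by rw [hϖ.maximalIdeal_eq]; exact Ideal.mem_span_singleton_self ϖ) hP
    (degreeLT A e ⊔ LinearMap.range (LinearMap.mulLeft A F))
    (fun p => by
      refine ⟨p %ₘ X ^ e + _, Submodule.add_mem_sup (mem_degreeLT.2 ?_) ⟨a * (p /ₘ X ^ e), rfl⟩,
        X ^ e * b * (p /ₘ X ^ e), -(Z * a * (p /ₘ X ^ e)) - X ^ e * b * x * (p /ₘ X ^ e), ?_⟩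
      · have := degree_modByMonic_lt p (monic_X_pow (R := A) e)
        rwa [degree_X_pow] at this
      · rw [LinearMap.mulLeft_apply]
        linear_combination -(modByMonic_add_div p (X ^ e)) - (p /ₘ X ^ e) * X ^ e * hab
          - a * (p /ₘ X ^ e) * hF - X ^ e * b * (p /ₘ X ^ e) * hx) (X ^ e)
  obtain ⟨r, hr, _, ⟨q, rfl⟩, rfl⟩ := Submodule.mem_sup.1 hs
  rw [LinearMap.mulLeft_apply] at e1
  rw [mem_degreeLT] at hr
  have key (i : ℕ) (hi : i ≤ e) : ϖ ∣ (X ^ e - r - X ^ e * (U * q)).coeff i := by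
    have : X ^ e - r - X ^ e * (U * q) - X ^ d * y = C ϖ * (Z * q + x * y) := by
      linear_combination e1 + q * hF + y * hx
    have h2 := congrArg (fun p => p.coeff i) this
    simp only [coeff_C_mul] at h2
    rw [coeff_sub, mul_comm (X ^ d), coeff_mul_X_pow', if_neg (by omega), sub_zero] at h2
    exact ⟨_, h2⟩
  refine ⟨r, q, y, by linear_combination e1, hr, ?_, ?_⟩
  · rw [C_dvd_iff_dvd_coeff]
    intro i
    by_cases hi : i < e
    · have := key i hi.le
      rw [coeff_sub, coeff_sub, coeff_X_pow, if_neg hi.ne, mul_comm, coeff_mul_X_pow',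
        if_neg (by omega)] at this
      simpa using this
    · rw [(degree_lt_iff_coeff_zero _ _).1 hr i (not_lt.1 hi)]
      exact dvd_zero _
  · have := key e le_rfl
    rw [coeff_sub, coeff_sub, coeff_X_pow, if_pos rfl, mul_comm, coeff_mul_X_pow',
      if_pos le_rfl, Nat.sub_self, (degree_lt_iff_coeff_zero _ _).1 hr e le_rfl, sub_zero,
      mul_coeff_zero] at this
    rw [isUnit_iff_not_dvd hϖ]
    intro h
    exact (isUnit_iff_not_dvd hϖ 1).1 isUnit_one
      (by simpa using dvd_add this (h.mul_left (U.coeff 0)))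

lemma Stab.of_not_dvd (hϖ : Irreducible ϖ) {f g : A[X]} (hf : C ϖ ∣ f - 1)
    (hf0 : f.coeff 0 = 1) (hg : g.degree < f.degree) (hgϖ : ¬ C ϖ ∣ g)
    (ih : ∀ h : A[X], h.natDegree < f.natDegree → C ϖ ∣ h - 1 → h.coeff 0 = 1 → Stab h f) :
    Stab f g := by
  obtain hd | hd := Nat.eq_zero_or_pos f.natDegree
  · rw [natDegree_eq_zero] at hd
    obtain ⟨c, rfl⟩ := hd
    rw [coeff_C_zero] at hf0
    rw [hf0, C_1]
    exact Stab.one_left g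
  obtain ⟨D, hD⟩ : ∃ D, f.natDegree = D + 1 := ⟨_, (Nat.succ_pred_eq_of_pos hd).symm⟩
  have hgD : g.natDegree ≤ D := by
    refine natDegree_le_of_degree_le (degree_le_of_lt_succ ?_)
    rw [← hD]
    exact hg.trans_le degree_le_natDegree
  set F := reflect D g with hF
  have hFg : reflect D F = g := reflect_reflect D g
  have hFD : F.natDegree ≤ D := natDegree_reflect_le_of_le hgD
  have hFϖ : ¬ C ϖ ∣ F := by
    rintro ⟨x, hx⟩
    rw [hx, reflect_C_mul] at hFg
    exact hgϖ ⟨_, hFg.symm⟩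
  obtain ⟨e, Z, U, hFe, hU, hFu⟩ := exists_eq_C_mul_add_X_pow_mul hϖ hFϖ
  have heD : e ≤ D := by
    by_contra! h
    rw [coeff_eq_zero_of_natDegree_lt (hFD.trans_lt h)] at hFu
    exact not_isUnit_zero hFu
  set P := reflect (D + 1) f with hP
  have hPf : reflect (D + 1) P = f := reflect_reflect _ f
  have hPD : P.natDegree ≤ D + 1 := natDegree_reflect_le_of_le hD.le
  have hPm : P.Monic := by
    refine monic_of_natDegree_le_of_coeff_eq_one (D + 1) hPD ?_
    rw [hP, coeff_reflect, revAt_le le_rfl, Nat.sub_self, hf0]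
  have hPX : C ϖ ∣ P - X ^ (D + 1) := by
    obtain ⟨x, hx⟩ := hf
    rw [hP, ← reflect_one, ← reflect_sub, hx, reflect_C_mul]
    exact dvd_mul_right _ _
  obtain ⟨r, q, z, hrqz, hr, hrϖ, hq⟩ :=
    exists_X_pow_eq hϖ (Nat.lt_succ_of_le heD) hFe hU hPm hPX
  set Nz := q.natDegree + z.natDegree with hNz
  set h := reflect e (X ^ e - r) with hh
  have hre : r.natDegree ≤ e := natDegree_le_of_degree_le hr.le
  have hXr : (X ^ e - r).natDegree ≤ e :=
    (natDegree_sub_le _ _).trans (max_le (natDegree_X_pow_le e) hre)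
  have key : X ^ (D + (Nz + 1) - e) * h = g * reflect (Nz + 1) q + f * reflect Nz z := by
    have h1 := reflect_mul 1 (X ^ e - r) (F := D + (Nz + 1) - e) (G := e) (by simp) hXr
    rw [Nat.sub_add_cancel (by omega), one_mul, reflect_one] at h1
    rw [← h1, hrqz, reflect_add, reflect_mul F q hFD (by omega),
      show D + (Nz + 1) = D + 1 + Nz by ring, reflect_mul P z hPD (by omega), hFg, hPf]
  have hQ : IsUnit (reflect (Nz + 1) q).leadingCoeff := by
    have h1 : (reflect (Nz + 1) q).coeff (Nz + 1) = q.coeff 0 := by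
      rw [coeff_reflect, revAt_le le_rfl, Nat.sub_self]
    have h2 : (reflect (Nz + 1) q).natDegree = Nz + 1 := by
      refine le_antisymm (natDegree_reflect_le_of_le (by omega)) (le_natDegree_of_ne_zero ?_)
      rw [h1]; exact hq.ne_zero
    rwa [leadingCoeff, h2, h1]
  have hr1 : h = 1 - reflect e r := by
    rw [hh, reflect_sub, reflect_monomial, revAt_le le_rfl, Nat.sub_self, pow_zero]
  have hs : Stab f (X ^ (D + (Nz + 1) - e) * h) := by
    refine (Stab.pow_right (Stab.X_left (by rw [hf0]; exact isUnit_one)).symm _).mul_right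
      (ih h ?_ ?_ ?_).symm
    · have : h.natDegree ≤ e := natDegree_reflect_le_of_le hXr
      omega
    · obtain ⟨x, hx⟩ := hrϖ
      rw [hr1, hx, reflect_C_mul]
      exact ⟨-reflect e x, by ring⟩
    · rw [hh, coeff_reflect, revAt_le (Nat.zero_le e), Nat.sub_zero, coeff_sub, coeff_X_pow_self,
        (degree_lt_iff_coeff_zero _ _).1 hr e le_rfl, sub_zero]
  rw [key] at hs
  refine Stab.of_mul_right (isCoprime_of_isUnit_leadingCoeff hϖ hf hQ)
    (Stab.of_isUnit_leadingCoeff hQ f).symm (Stab.add_right (reflect Nz z) ?_)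
  rwa [mul_comm (reflect (Nz + 1) q)]

lemma Stab.of_dvd_sub_one (hϖ : Irreducible ϖ) {f : A[X]} (hf : C ϖ ∣ f - 1)
    (hf0 : f.coeff 0 = 1) (g : A[X]) : Stab f g := by
  induction hd : f.natDegree using Nat.strong_induction_on generalizing f g with
  | _ d ih =>
  have hfne : f ≠ 0 := by rintro rfl; simp at hf0
  refine Stab.of_low_degree f (isCoprime_C hϖ hf (leadingCoeff_ne_zero.2 hfne))
    (Stab.C_right hϖ hf (leadingCoeff_ne_zero.2 hfne)) (fun g hg => ?_) g
  by_cases hg0 : g = 0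
  · intro h k e
    have hu : IsUnit f := .of_mul_eq_one k (by rw [hg0] at e; linear_combination e)
    exact Stab.of_isUnit_left hu _ _ _ _
  obtain ⟨n, g', hg', rfl⟩ := WfDvdMonoid.max_power_factor hg0
    ((prime_C_iff.2 hϖ.prime).irreducible)
  refine (Stab.pow_right (Stab.C_right hϖ hf hϖ.ne_zero) n).mul_right
    (Stab.of_not_dvd hϖ hf hf0 (lt_of_le_of_lt ?_ hg) hg' fun h hh h1 h2 =>
      ih _ (hd ▸ hh) h1 h2 f rfl)
  rw [← C_pow, degree_C_mul (pow_ne_zero n hϖ.ne_zero)]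

end DVR

end SLElem

namespace SLElem

open Polynomial Matrix Matrix.SpecialLinearGroup

section Local

variable {A : Type*} [CommRing A] [IsDomain A] [IsDiscreteValuationRing A] {ϖ : A}

lemma Stab.of_C_dvd_sub_one (hϖ : Irreducible ϖ) {f : A[X]} (hf : C ϖ ∣ f - 1) (g : A[X]) :
    Stab f g := by
  have h0 : ϖ ∣ f.coeff 0 - 1 := by
    simpa using (C_dvd_iff_dvd_coeff _ _).1 hf 0
  have hu : IsUnit (f.coeff 0) := by
    rw [isUnit_iff_not_dvd hϖ]
    intro h
    exact (isUnit_iff_not_dvd hϖ 1).1 isUnit_one (by simpa using dvd_sub h h0)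
  obtain ⟨u, hu'⟩ := hu.exists_right_inv
  have h1 : C (f.coeff 0) * C u = 1 := by rw [← C_mul, hu', C_1]
  have hs : Stab (C u * f) g := by
    refine Stab.of_dvd_sub_one hϖ ?_ (by rw [coeff_C_mul, mul_comm, hu']) g
    have h2 : C ϖ ∣ C (f.coeff 0) - 1 := by
      rw [← C_1, ← C_sub]; exact map_dvd C h0
    have : C u * f - 1 = C u * ((f - 1) - (C (f.coeff 0) - 1)) := by
      linear_combination h1
    rw [this]
    exact (dvd_sub hf h2).mul_left _
  have : f = C (f.coeff 0) * (C u * f) := by rw [← mul_assoc, h1, one_mul]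
  rw [this]
  exact ((Stab.of_isUnit_right (isUnit_C.2 hu) g).mul_right hs.symm).symm

lemma C_dvd_iff_map_residue (hϖ : Irreducible ϖ) (p : A[X]) :
    C ϖ ∣ p ↔ mapRingHom (IsLocalRing.residue A) p = 0 := by
  rw [C_dvd_iff_dvd_coeff, Polynomial.ext_iff]
  refine forall_congr' fun i => ?_
  rw [coe_mapRingHom, coeff_map, coeff_zero, IsLocalRing.residue_eq_zero_iff, hϖ.maximalIdeal_eq,
    Ideal.mem_span_singleton]

lemma mapRingHom_residue_surjective :
    Function.Surjective (mapRingHom (IsLocalRing.residue A)) := by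
  rw [coe_mapRingHom]
  exact map_surjective _ IsLocalRing.residue_surjective

lemma blk_mem_elem_of_isDiscreteValuationRing (M : SpecialLinearGroup (Fin 2) A[X]) :
    blk M ∈ elem A[X] Finset.univ := by
  obtain ⟨ϖ, hϖ⟩ := IsDiscreteValuationRing.exists_irreducible A
  set ψ := mapRingHom (IsLocalRing.residue A) with hψ
  obtain ⟨E, hE, hEM⟩ := exists_lift_elem (mapRingHom_residue_surjective (A := A))
    (mem_elem_of_euclideanDomain (SpecialLinearGroup.map ψ M))
  have h1 : SpecialLinearGroup.map ψ (M * E⁻¹) = 1 := by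
    rw [map_mul, map_inv, hEM, mul_inv_cancel]
  have h2 : blk (M * E⁻¹) ∈ elem A[X] Finset.univ := by
    rw [mkTwo_eta (M * E⁻¹)]
    refine Stab.of_C_dvd_sub_one hϖ ?_ _ _ _ _
    rw [C_dvd_iff_map_residue hϖ, map_sub, map_one]
    have := congrArg (fun N => N.1 0 0) h1
    change ψ ((M * E⁻¹).1 0 0) = 1 at this
    rw [this, sub_self]
  rw [map_mul, map_inv] at h2
  exact (Subgroup.mul_mem_cancel_right _ (inv_mem (blk_mem_elem hE))).1 h2

variable {ι : Type*} [Fintype ι] [DecidableEq ι]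

lemma Red.exists_sub_mem (hϖ : Irreducible ϖ) {S : Finset ι} (hS : 2 < S.card) {i : ι}
    (hi : i ∈ S) (v : ι → A[X]) (hv : ∀ j ∉ S, v j = 0) (hu : ∃ u, v ⬝ᵥ u = 1) :
    ∃ w, Red S v w ∧ C ϖ ∣ w i - 1 := by
  set ψ := mapRingHom (IsLocalRing.residue A) with hψ
  obtain ⟨l, hl⟩ := (Finset.card_pos (s := S.erase i)).1 (by rw [Finset.card_erase_of_mem hi]; omega)
  obtain ⟨hli, hl⟩ := Finset.mem_erase.1 hl
  have hu' : ∃ u, (fun j => ψ (v j)) ⬝ᵥ u = 1 := by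
    obtain ⟨u, hu⟩ := hu
    refine ⟨fun j => ψ (u j), ?_⟩
    rw [← map_one ψ, ← hu, dotProduct, dotProduct, map_sum]
    simp only [map_mul]
  have hv' : ∀ j ∉ S, ψ (v j) = 0 := fun j hj => by rw [hv j hj, map_zero]
  obtain ⟨w, hw, hw0⟩ := Red.exists_eq_zero hi (fun j => ψ (v j))
  obtain ⟨E, hE, hEw⟩ := hw.trans (Red.single_of_zero hi hl hli.symm
    (fun j hj => (hw.eq_of_notMem hj).trans (hv' j hj)) (hw.unimodular hu') (hw0 l hl hli))
  obtain ⟨F, hF, rfl⟩ := exists_lift_elem (mapRingHom_residue_surjective (A := A)) hE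
  refine ⟨_, ⟨F, hF, rfl⟩, ?_⟩
  have := congrFun hEw i
  rw [Pi.single_eq_same] at this
  rw [C_dvd_iff_map_residue hϖ, map_sub, map_one, sub_eq_zero, ← this]
  simp only [Matrix.vecMul, dotProduct, map_sum, map_mul]
  rfl

lemma exists_surjective_quotient (hϖ : Irreducible ϖ) {a : A[X]} (ha : C ϖ ∣ a - 1) :
    ∃ φ : (FractionRing A)[X] →+* A[X] ⧸ Ideal.span {a}, Function.Surjective φ := by
  let q := Ideal.Quotient.mk (Ideal.span {a})
  have hq (s : nonZeroDivisors A) : IsUnit ((q.comp C) s) := by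
    obtain ⟨x, y, e⟩ := isCoprime_C hϖ ha (nonZeroDivisors.ne_zero s.2)
    refine .of_mul_eq_one (q y) ?_
    rw [RingHom.comp_apply, ← map_mul, ← map_one q, eq_comm]
    refine Ideal.Quotient.eq.2 (Ideal.mem_span_singleton.2 ⟨x, ?_⟩)
    linear_combination -e
  let g : FractionRing A →+* A[X] ⧸ Ideal.span {a} := IsLocalization.lift hq
  refine ⟨eval₂RingHom g (q X), fun x => ?_⟩
  obtain ⟨p, rfl⟩ := Ideal.Quotient.mk_surjective x
  refine ⟨mapRingHom (algebraMap A (FractionRing A)) p, ?_⟩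
  have : ((eval₂RingHom g (q X)).comp (mapRingHom (algebraMap A (FractionRing A)))) = q := by
    refine Polynomial.ringHom_ext (fun c => ?_) ?_
    · simp [g, IsLocalization.lift_eq]
    · simp
  exact congrArg (fun f => f p) this

lemma Red.single_of_isDiscreteValuationRing {S : Finset ι} (hS : 2 < S.card) {i : ι}
    (hi : i ∈ S) (v : ι → A[X]) (hv : ∀ j ∉ S, v j = 0) (hu : ∃ u, v ⬝ᵥ u = 1) :
    Red S v (Pi.single i 1) := by
  obtain ⟨ϖ, hϖ⟩ := IsDiscreteValuationRing.exists_irreducible A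
  obtain ⟨w, hw, ha⟩ := Red.exists_sub_mem hϖ hS hi v hv hu
  obtain ⟨φ, hφ⟩ := exists_surjective_quotient hϖ ha
  obtain ⟨j, hj, l, hl, hjl⟩ := Finset.one_lt_card.1
    (show 1 < (S.erase i).card by rw [Finset.card_erase_of_mem hi]; omega)
  obtain ⟨w', hw', h0⟩ := Red.exists_map_eq_zero hφ Ideal.Quotient.mk_surjective hj w
  have hi' : w' i = w i := hw'.eq_of_notMem (Finset.notMem_erase i S)
  obtain ⟨b, hb⟩ := Ideal.mem_span_singleton.1 (Ideal.Quotient.eq_zero_iff_mem.1 (h0 l hl hjl.symm))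
  obtain ⟨hli, hl⟩ := Finset.mem_erase.1 hl
  have hr := (hw.trans (hw'.mono (Finset.erase_subset i S))).trans
    (Red.add hli.symm hi hl (-b) w')
  refine hr.trans (Red.single_of_zero hi hl hli.symm
    (fun k hk => (hr.eq_of_notMem hk).trans (hv k hk)) (hr.unimodular hu) ?_)
  rw [Function.update_self, hb, hi']
  ring

theorem mem_elem_of_isDiscreteValuationRing (hι : 3 ≤ Fintype.card ι)
    (M : SpecialLinearGroup ι A[X]) : M ∈ elem A[X] Finset.univ := by
  refine mem_elem_of_supp (m := 2) ?_ (fun S hS i hi v hv hu =>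
    Red.single_of_isDiscreteValuationRing hS hi v hv hu) (Fintype.card ι - 2) Finset.univ
    (by rw [Finset.card_univ]; omega) M (mem_supp_univ M)
  intro T hT M hM
  obtain ⟨i, j, hij, rfl⟩ := Finset.card_eq_two.1 hT
  obtain ⟨l, hl⟩ := Finset.exists_mem_notMem_of_card_lt_card
    (s := {i, j}) (t := (Finset.univ : Finset ι)) (by rw [hT, Finset.card_univ]; omega)
  simp only [Finset.mem_univ, Finset.mem_insert, Finset.mem_singleton, not_or, true_and] at hl
  let e : Fin 3 ↪ ι := ⟨![i, j, l], by
    intro a b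
    fin_cases a <;> fin_cases b <;> simp [hij, hij.symm, hl.1, hl.2, Ne.symm hl.1, Ne.symm hl.2]⟩
  obtain ⟨N, rfl⟩ := eq_extend_of_mem_supp (Fin.castSuccEmb.trans e) (by
    intro x hx
    rw [Finset.mem_insert, Finset.mem_singleton] at hx
    rcases hx with rfl | rfl
    · exact ⟨0, rfl⟩
    · exact ⟨1, rfl⟩) hM
  rw [extend_trans]
  exact extend_mem_elem e (blk_mem_elem_of_isDiscreteValuationRing N)

theorem mem_elem_intPolynomial (hι : 3 ≤ Fintype.card ι) (M : SpecialLinearGroup ι ℤ[X]) :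
    M ∈ elem ℤ[X] Finset.univ := by
  have : Nonempty ι := Fintype.card_pos_iff.1 (by omega)
  refine mem_elem_of_local hι M (mem_elem_of_euclideanDomain _) fun m hm => ?_
  have : IsDiscreteValuationRing (Localization.AtPrime m) :=
    IsLocalization.AtPrime.isDiscreteValuationRing_of_dedekind_domain ℤ
      (Ring.ne_bot_of_isMaximal_of_not_isField hm Int.not_isField) _
  exact mem_elem_of_isDiscreteValuationRing hι _

end Local

end SLElem

namespace SLElem

open Matrix Matrix.SpecialLinearGroup

section Diagonal

variable {ι : Type*} [Fintype ι] [DecidableEq ι] {R : Type*} [CommRing R]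

lemma val_mul_val_inv (M : SpecialLinearGroup ι R) : M.1 * (M⁻¹).1 = 1 :=
  congrArg Subtype.val (mul_inv_cancel M)

lemma val_inv_mul_val (M : SpecialLinearGroup ι R) : (M⁻¹).1 * M.1 = 1 :=
  congrArg Subtype.val (inv_mul_cancel M)

lemma exists_mul_diagonal_eq (u : ι → Rˣ) {E : SpecialLinearGroup ι R}
    (hE : E ∈ elem R (Finset.univ : Finset ι)) :
    ∃ E' ∈ elem R (Finset.univ : Finset ι),
      E.1 * diagonal (fun i => (u i : R)) = diagonal (fun i => (u i : R)) * E'.1 := by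
  induction hE using Subgroup.closure_induction with
  | mem x hx =>
    obtain ⟨i, j, h, c, -, -, rfl⟩ := hx
    refine ⟨_, transvection_mem_univ h (↑(u i)⁻¹ * c * u j), ?_⟩
    rw [transvection_coe, transvection_coe, add_mul, mul_add, one_mul, mul_one]
    congr 1
    ext1 a b
    rw [mul_diagonal, diagonal_mul, single_apply, single_apply]
    split_ifs with hab
    · rw [← hab.1, ← hab.2, mul_assoc, Units.mul_inv_cancel_left]
    · rw [zero_mul, mul_zero]
  | one => exact ⟨1, one_mem _, by rw [coe_one, one_mul, mul_one]⟩
  | mul x y _ _ hx hy =>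
    obtain ⟨x', hx', ex⟩ := hx
    obtain ⟨y', hy', ey⟩ := hy
    refine ⟨x' * y', mul_mem hx' hy', ?_⟩
    rw [coe_mul, coe_mul, mul_assoc, ey, ← mul_assoc, ex, mul_assoc]
  | inv x _ hx =>
    obtain ⟨x', hx', ex⟩ := hx
    refine ⟨x'⁻¹, inv_mem hx', ?_⟩
    calc _ = (x⁻¹).1 * (diagonal (fun i => (u i : R)) * x'.1) * (x'⁻¹).1 := by
          rw [mul_assoc, mul_assoc, val_mul_val_inv, mul_one]
      _ = _ := by rw [← ex, ← mul_assoc, val_inv_mul_val, one_mul]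

lemma mkTwo_diag_mem (a d : R) (h : a * d - 0 * 0 = 1) :
    mkTwo a 0 0 d h ∈ elem R (Finset.univ : Finset (Fin 2)) := by
  have u (c : R) : mkTwo 1 c 0 1 (by ring) ∈ elem R (Finset.univ : Finset (Fin 2)) := by
    rw [← transvection_zero_one]; exact transvection_mem_univ _ _
  have l (c : R) : mkTwo 1 0 c 1 (by ring) ∈ elem R (Finset.univ : Finset (Fin 2)) := by
    rw [← transvection_one_zero]; exact transvection_mem_univ _ _
  have key : mkTwo a 0 0 d h = mkTwo 1 a 0 1 (by ring) * mkTwo 1 0 (-d) 1 (by ring) *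
      mkTwo 1 a 0 1 (by ring) * mkTwo 1 (-1) 0 1 (by ring) * mkTwo 1 0 1 1 (by ring) *
      mkTwo 1 (-1) 0 1 (by ring) := by
    simp only [mkTwo_mul]
    congr 1
    · linear_combination a * h
    · linear_combination -h
    · linear_combination h
    · ring
  rw [key]
  exact mul_mem (mul_mem (mul_mem (mul_mem (mul_mem (u _) (l _)) (u _)) (u _)) (l _)) (u _)

lemma diagonal_mem_elem_of_pair {a b : ι} (hab : a ≠ b) (M : SpecialLinearGroup ι R)
    (hd : ∀ i j, i ≠ j → M.1 i j = 0) (h1 : ∀ i, i ≠ a → i ≠ b → M.1 i i = 1) :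
    M ∈ elem R (Finset.univ : Finset ι) := by
  let e : Fin 2 ↪ ι := ⟨![a, b], by
    intro x y; fin_cases x <;> fin_cases y <;> simp [hab, hab.symm]⟩
  obtain ⟨N, rfl⟩ := eq_extend_of_mem_supp (S := {a, b}) e (by
    intro x hx
    rw [Finset.mem_insert, Finset.mem_singleton] at hx
    rcases hx with rfl | rfl
    · exact ⟨0, rfl⟩
    · exact ⟨1, rfl⟩) (M := M) (by
    intro i hi j
    rw [Finset.mem_insert, Finset.mem_singleton, not_or] at hi
    obtain rfl | hij := eq_or_ne i j
    · rw [h1 i hi.1 hi.2, one_apply_eq]; exact ⟨rfl, rfl⟩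
    · rw [hd i j hij, hd j i hij.symm, one_apply_ne hij, one_apply_ne hij.symm]; exact ⟨rfl, rfl⟩)
  have hN (x y : Fin 2) (hxy : x ≠ y) : N.1 x y = 0 := by
    have := hd (e x) (e y) (e.injective.ne hxy)
    rw [extend_coe, Matrix.add_apply, one_apply_ne (e.injective.ne hxy), zero_add,
      embMat_mul_mul_apply, Finset.sum_eq_single x, Finset.sum_eq_single y] at this
    · simpa [one_apply_ne hxy] using this
    · intro z _ hz; simp [hz.symm]
    · simp
    · intro z _ hz; simp [hz.symm]
    · simp
  refine extend_mem_elem e ?_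
  have h01 := hN 0 1 (by decide)
  have h10 := hN 1 0 (by decide)
  have hdet := N.2
  rw [det_fin_two, h01, h10] at hdet
  have : N = mkTwo (N.1 0 0) 0 0 (N.1 1 1) hdet := by
    refine Subtype.ext ?_
    conv_lhs => rw [eta_fin_two N.1, h01, h10]
    rfl
  rw [this]
  exact mkTwo_diag_mem _ _ _

/-- Diagonal matrices of determinant one are elementary. -/
lemma diagonal_mem_elem (M : SpecialLinearGroup ι R) (hd : ∀ i j, i ≠ j → M.1 i j = 0) :
    M ∈ elem R (Finset.univ : Finset ι) := by
  suffices ∀ S : Finset ι, ∀ M : SpecialLinearGroup ι R, (∀ i j, i ≠ j → M.1 i j = 0) →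
      (∀ i ∉ S, M.1 i i = 1) → M ∈ elem R (Finset.univ : Finset ι) from
    this Finset.univ M hd (fun i hi => absurd (Finset.mem_univ i) hi)
  intro S
  induction S using Finset.induction_on with
  | empty =>
    intro M hd h1
    have : M = 1 := by
      refine Subtype.ext ?_
      ext1 i j
      obtain rfl | hij := eq_or_ne i j
      · rw [h1 i (Finset.notMem_empty i), coe_one, one_apply_eq]
      · rw [hd i j hij, coe_one, one_apply_ne hij]
    rw [this]; exact one_mem _
  | insert a S ha ih =>
    intro M hd h1
    have hM : M.1 = diagonal (fun i => M.1 i i) := by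
      ext1 i j
      obtain rfl | hij := eq_or_ne i j
      · rw [diagonal_apply_eq]
      · rw [hd i j hij, diagonal_apply_ne _ hij]
    have hdet := M.2
    rw [hM, det_diagonal] at hdet
    obtain rfl | ⟨b, hb⟩ := S.eq_empty_or_nonempty
    · refine ih M hd fun i _ => ?_
      obtain rfl | hi := eq_or_ne i a
      · rwa [Finset.prod_eq_single i (fun j _ hj => h1 j (by simpa using hj)) (by simp)] at hdet
      · exact h1 i (by simpa using hi)
    · have hab : a ≠ b := by rintro rfl; exact ha hb
      obtain ⟨v, hv⟩ : ∃ v, M.1 a a * v = 1 := by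
        rw [← Finset.mul_prod_erase _ _ (Finset.mem_univ a)] at hdet
        exact ⟨_, hdet⟩
      let H : SpecialLinearGroup ι R := ⟨diagonal (fun i => if i = a then v else
        if i = b then M.1 a a else 1), by
        rw [det_diagonal, ← Finset.mul_prod_erase _ _ (Finset.mem_univ a), if_pos rfl,
          Finset.prod_eq_single b, if_neg hab.symm, if_pos rfl, mul_comm, hv]
        · intro i hi hib
          rw [if_neg (Finset.ne_of_mem_erase hi), if_neg hib]
        · intro h; exact absurd (Finset.mem_erase.2 ⟨hab.symm, Finset.mem_univ b⟩) h⟩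
      have hH : H ∈ elem R (Finset.univ : Finset ι) :=
        diagonal_mem_elem_of_pair hab H (fun i j hij => diagonal_apply_ne _ hij)
          (fun i hia hib => by
            change diagonal _ i i = _
            rw [diagonal_apply_eq, if_neg hia, if_neg hib])
      refine (Subgroup.mul_mem_cancel_right _ hH).1 (ih _ (fun i j hij => ?_) fun i hi => ?_)
      · change (M.1 * diagonal (_ : ι → R)) i j = 0
        rw [mul_diagonal, hd i j hij, zero_mul]
      · change (M.1 * diagonal (_ : ι → R)) i i = 1
        rw [mul_diagonal]
        have hib : i ≠ b := by rintro rfl; exact hi hb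
        obtain rfl | hia := eq_or_ne i a
        · rw [if_pos rfl, hv]
        · rw [if_neg hia, if_neg hib, h1 i (by simp [hia, hi]), one_mul]

end Diagonal

section Laurent

open Polynomial LaurentPolynomial

variable {ι : Type*} [Fintype ι] [DecidableEq ι]

lemma exists_map_toLaurent_eq (hι : 3 ≤ Fintype.card ι) (k : ℕ) : ∀ P : Matrix ι ι ℤ[X],
    P.det = X ^ k → ∃ u : ι → ℤ[T;T⁻¹]ˣ, ∃ E ∈ elem ℤ[T;T⁻¹] (Finset.univ : Finset ι),
      toLaurent.mapMatrix P = diagonal (fun i => (u i : ℤ[T;T⁻¹])) * E.1 := by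
  induction k with
  | zero =>
    intro P hP
    rw [pow_zero] at hP
    refine ⟨1, _, map_mem_elem toLaurent (mem_elem_intPolynomial hι ⟨P, hP⟩), ?_⟩
    simp only [Pi.one_apply, Units.val_one, diagonal_one, one_mul]
    rfl
  | succ k ih =>
    intro P hP
    have : Nonempty ι := Fintype.card_pos_iff.1 (by omega)
    let i : ι := Classical.arbitrary ι
    have h0 : ((evalRingHom (0 : ℤ)).mapMatrix P).det = 0 := by
      rw [← RingHom.map_det, hP]; simp
    obtain ⟨v, hv, hvP⟩ := exists_vecMul_eq_zero_iff.2 h0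
    obtain ⟨w, ⟨F, hF, rfl⟩, hw⟩ := Red.exists_eq_zero (Finset.mem_univ i) v
    set c := (v ᵥ* F.1) i with hc
    have hwc : v ᵥ* F.1 = Pi.single i c := by
      ext j
      obtain rfl | hj := eq_or_ne j i
      · rw [Pi.single_eq_same]
      · rw [Pi.single_eq_of_ne hj, hw j (Finset.mem_univ j) hj]
    have hvc : v = Pi.single i c ᵥ* (F⁻¹).1 := by
      rw [← hwc, vecMul_vecMul, val_mul_val_inv, vecMul_one]
    have hc0 : c ≠ 0 := by
      intro h
      rw [h, Pi.single_zero, zero_vecMul] at hvc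
      exact hv hvc
    set G : Matrix ι ι ℤ[X] := (SpecialLinearGroup.map Polynomial.C F⁻¹).1 * P with hG
    have hrow (j : ι) : X ∣ G i j := by
      rw [X_dvd_iff, coeff_zero_eq_eval_zero]
      have h1 : ((F⁻¹).1 * (evalRingHom (0 : ℤ)).mapMatrix P) i j = 0 := by
        rw [hvc, vecMul_vecMul] at hvP
        have := congrFun hvP j
        rw [single_vecMul] at this
        exact (mul_eq_zero.1 this).resolve_left hc0
      refine Eq.trans ?_ h1
      rw [hG, mul_apply, mul_apply, eval_finsetSum]
      refine Finset.sum_congr rfl fun l _ => ?_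
      rw [eval_mul]
      exact congrArg (· * eval 0 (P l j)) eval_C
    choose q hq using hrow
    set P' : Matrix ι ι ℤ[X] := G.updateRow i q with hP'
    have hGP : G = diagonal (fun l => if l = i then X else 1) * P' := by
      ext1 a b
      rw [diagonal_mul, hP']
      obtain rfl | ha := eq_or_ne a i
      · rw [if_pos rfl, updateRow_self, hq]
      · rw [if_neg ha, updateRow_ne ha, one_mul]
    have hdet : P'.det = X ^ k := by
      have h1 : G.det = X ^ (k + 1) := by
        rw [hG, det_mul, hP, (SpecialLinearGroup.map Polynomial.C F⁻¹).2, one_mul]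
      rw [hGP, det_mul, det_diagonal, Finset.prod_ite_eq' , if_pos (Finset.mem_univ i),
        pow_succ'] at h1
      exact mul_left_cancel₀ X_ne_zero h1
    obtain ⟨u, E, hE, e⟩ := ih P' hdet
    let t : ℤ[T;T⁻¹]ˣ := ⟨T 1, T (-1), by rw [← T_add, add_neg_cancel, T_zero],
      by rw [← T_add, neg_add_cancel, T_zero]⟩
    have hPG : P = (SpecialLinearGroup.map Polynomial.C F).1 * G := by
      rw [hG, ← mul_assoc, map_inv, val_mul_val_inv, one_mul]
    obtain ⟨F', hF', eF⟩ := exists_mul_diagonal_eq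
      (fun l => (if l = i then t else 1) * u l)
      (map_mem_elem toLaurent (map_mem_elem Polynomial.C hF))
    refine ⟨fun l => (if l = i then t else 1) * u l, F' * E, mul_mem hF' hE, ?_⟩
    change _ = diagonal (fun l => (((if l = i then t else 1) * u l : ℤ[T;T⁻¹]ˣ) : ℤ[T;T⁻¹])) *
      (F'.1 * E.1)
    have hD : toLaurent.mapMatrix (diagonal (fun l => if l = i then (X : ℤ[X]) else 1)) =
        diagonal (fun l => ((if l = i then t else 1 : ℤ[T;T⁻¹]ˣ) : ℤ[T;T⁻¹])) := by
      rw [RingHom.mapMatrix_apply, diagonal_map (map_zero _)]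
      congr 1
      ext1 l
      split_ifs
      · exact toLaurent_X
      · exact map_one _
    have hmap : toLaurent.mapMatrix (SpecialLinearGroup.map Polynomial.C F).1 =
      (SpecialLinearGroup.map toLaurent (SpecialLinearGroup.map Polynomial.C F)).1 := rfl
    rw [← mul_assoc, ← eF, hPG, map_mul, hGP, map_mul, e, hD, hmap, mul_assoc, ← mul_assoc _ _ E.1,
      diagonal_mul_diagonal]
    simp only [Units.val_mul]

theorem mem_elem_intLaurent (hι : 3 ≤ Fintype.card ι) (M : SpecialLinearGroup ι ℤ[T;T⁻¹]) :
    M ∈ elem ℤ[T;T⁻¹] (Finset.univ : Finset ι) := by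
  choose d p hp using fun ab : ι × ι => exists_T_pow (M.1 ab.1 ab.2)
  let N := ∑ ab, d ab
  have hN (ab : ι × ι) : d ab ≤ N := Finset.single_le_sum (fun _ _ => Nat.zero_le _)
    (Finset.mem_univ ab)
  let P : Matrix ι ι ℤ[X] := Matrix.of fun a b => p (a, b) * X ^ (N - d (a, b))
  have hP : toLaurent.mapMatrix P = (T (N : ℤ) : ℤ[T;T⁻¹]) • M.1 := by
    ext1 a b
    change toLaurent (p (a, b) * X ^ (N - d (a, b))) = T N * M.1 a b
    rw [map_mul, hp, toLaurent_X_pow, mul_assoc, ← T_add, mul_comm, Nat.cast_sub (hN _)]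
    congr 2
    ring
  have hdet : P.det = X ^ (N * Fintype.card ι) := by
    apply toLaurent_injective
    rw [RingHom.map_det, hP, det_smul, M.2, mul_one, toLaurent_X_pow, T_pow]
    congr 1
    push_cast; ring
  obtain ⟨u, E, hE, e⟩ := exists_map_toLaurent_eq hι _ P hdet
  rw [hP] at e
  have hM : M.1 = diagonal (fun i => T (-N) * (u i : ℤ[T;T⁻¹])) * E.1 := by
    have h1 : diagonal (fun i => T (-N) * (u i : ℤ[T;T⁻¹])) =
        (T (-N) : ℤ[T;T⁻¹]) • diagonal (fun i => (u i : ℤ[T;T⁻¹])) := by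
      rw [← diagonal_smul]; rfl
    rw [h1, smul_mul_assoc, ← e, smul_smul, ← T_add, neg_add_cancel, T_zero, one_smul]
  have hD : (diagonal (fun i => T (-N) * (u i : ℤ[T;T⁻¹]))).det = 1 := by
    have := M.2
    rwa [hM, det_mul, E.2, mul_one] at this
  let D : SpecialLinearGroup ι ℤ[T;T⁻¹] := ⟨_, hD⟩
  have : M = D * E := Subtype.ext hM
  rw [this]
  exact mul_mem (diagonal_mem_elem _ fun i j hij => diagonal_apply_ne _ hij) hE

end Laurent

end SLElem

namespace SLElem

open Matrix Matrix.SpecialLinearGroup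

lemma exists_ne_ne {ι : Type*} [Fintype ι] (hι : 3 ≤ Fintype.card ι) (i j : ι) :
    ∃ m, m ≠ i ∧ m ≠ j := by
  classical
  by_contra! h
  have : (Finset.univ : Finset ι) ⊆ {i, j} := fun m _ => by
    by_cases hm : m = i
    · simp [hm]
    · simp [h m hm]
  have := (Finset.card_le_card this).trans Finset.card_le_two
  rw [Finset.card_univ] at this
  omega

section Orthogonal

variable {ι : Type*} [Fintype ι] {A : Type*} [AddCommGroup A]

/-- A map on pairs of integer vectors that is additive in each variable on orthogonal pairs. -/
structure OrthAdditive (c : (ι → ℤ) → (ι → ℤ) → A) : Prop where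
  add_left : ∀ v v' w, w ⬝ᵥ v = 0 → w ⬝ᵥ v' = 0 → c (v + v') w = c v w + c v' w
  add_right : ∀ v w w', w ⬝ᵥ v = 0 → w' ⬝ᵥ v = 0 → c v (w + w') = c v w + c v w'

namespace OrthAdditive

variable {c : (ι → ℤ) → (ι → ℤ) → A}

lemma swap (hc : OrthAdditive c) : OrthAdditive (fun v w => c w v) where
  add_left v v' w h h' := hc.add_right _ _ _ (by rwa [dotProduct_comm]) (by rwa [dotProduct_comm])
  add_right v w w' h h' := hc.add_left _ _ _ (by rwa [dotProduct_comm]) (by rwa [dotProduct_comm])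

lemma exists_left (hc : OrthAdditive c) (w : ι → ℤ) :
    ∃ f : LinearMap.ker (dotProductBilin ℤ ℤ w) →+ A, ∀ v, f v = c v w :=
  ⟨AddMonoidHom.mk' (fun v => c v w) fun v v' => hc.add_left _ _ _ v.2 v'.2, fun _ => rfl⟩

lemma smul_left (hc : OrthAdditive c) (z : ℤ) (v w : ι → ℤ) (h : w ⬝ᵥ v = 0) :
    c (z • v) w = z • c v w := by
  obtain ⟨f, hf⟩ := hc.exists_left w
  rw [← hf ⟨v, h⟩, ← map_zsmul, hf]; rfl

lemma smul_right (hc : OrthAdditive c) (z : ℤ) (v w : ι → ℤ) (h : w ⬝ᵥ v = 0) :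
    c v (z • w) = z • c v w :=
  hc.swap.smul_left z w v (by rwa [dotProduct_comm])

lemma sum_left (hc : OrthAdditive c) {κ : Type*} (s : Finset κ) (v : κ → ι → ℤ) (w : ι → ℤ)
    (h : ∀ k, w ⬝ᵥ v k = 0) : c (∑ k ∈ s, v k) w = ∑ k ∈ s, c (v k) w := by
  obtain ⟨f, hf⟩ := hc.exists_left w
  have := map_sum f (fun k => ⟨v k, h k⟩) s
  simpa only [hf, AddSubmonoidClass.coe_finsetSum] using this

lemma zero_left (hc : OrthAdditive c) (w : ι → ℤ) : c 0 w = 0 := by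
  simpa using hc.smul_left 0 0 w (dotProduct_zero w)

variable [DecidableEq ι]

lemma single_right (hc : OrthAdditive c)
    (hE : ∀ i j, i ≠ j → c (Pi.single i 1) (Pi.single j 1) = 0) {v : ι → ℤ} {i : ι}
    (hv : v i = 0) : c v (Pi.single i 1) = 0 := by
  have : v = ∑ k, v k • Pi.single k (1 : ℤ) := by
    ext j; simp [Finset.sum_apply, Pi.single_apply]
  rw [this, hc.sum_left]
  · refine Finset.sum_eq_zero fun k _ => ?_
    obtain rfl | hk := eq_or_ne k i
    · rw [hv, zero_smul, hc.zero_left]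
    · rw [hc.smul_left, hE k i hk, smul_zero]
      simp [hk]
  · intro k
    obtain rfl | hk := eq_or_ne k i
    · simp [hv]
    · simp [hk.symm]

lemma single_left (hc : OrthAdditive c)
    (hE : ∀ i j, i ≠ j → c (Pi.single i 1) (Pi.single j 1) = 0) {w : ι → ℤ} {i : ι}
    (hw : w i = 0) : c (Pi.single i 1) w = 0 :=
  hc.swap.single_right (fun i j h => hE j i h.symm) hw

set_option linter.unusedSimpArgs false in
/-- An orthogonally additive map that vanishes on pairs of distinct basis vectors and on the
pairs `(e i - e o, e i + e o)` vanishes on all orthogonal pairs with unimodular second entry. -/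
theorem eq_zero_of_unimodular (hι : 3 ≤ Fintype.card ι) (hc : OrthAdditive c)
    (hE : ∀ i j, i ≠ j → c (Pi.single i 1) (Pi.single j 1) = 0) (o : ι)
    (hD : ∀ i, i ≠ o → c (Pi.single i 1 - Pi.single o 1) (Pi.single i 1 + Pi.single o 1) = 0)
    {u v w : ι → ℤ} (hv : w ⬝ᵥ v = 0) (hu : u ⬝ᵥ w = 1) : c v w = 0 := by
  let e (i : ι) : ι → ℤ := Pi.single i 1
  have dr (v : ι → ℤ) (i : ι) : e i ⬝ᵥ v = v i := by simp [e]
  have es (i : ι) : e i i = 1 := Pi.single_eq_same i 1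
  have en {i j : ι} (h : i ≠ j) : e i j = 0 := Pi.single_eq_of_ne h.symm 1
  have hr (z : ℤ) (v : ι → ℤ) (i : ι) (hv : v i = 0) : c v (z • e i) = 0 := by
    rw [hc.smul_right _ _ _ (by rw [dr, hv]), hc.single_right hE hv, smul_zero]
  have hl (z : ℤ) (w : ι → ℤ) (i : ι) (hw : w i = 0) : c (z • e i) w = 0 := by
    rw [hc.smul_left _ _ _ (by rw [dotProduct_comm, dr, hw]), hc.single_left hE hw, smul_zero]
  let D (i j : ι) (a : ℤ) : A := c (a • e i - e j) (e i + a • e j)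
  have D0 {i j : ι} (h : i ≠ j) : D i j 0 = 0 := by
    have := hl (-1) (e i) j (en h)
    simpa [D] using this
  have sl (v' v'' : ι → ℤ) {v w : ι → ℤ} (h : v = v' + v'') (h' : w ⬝ᵥ v' = 0)
      (h'' : w ⬝ᵥ v'' = 0) : c v w = c v' w + c v'' w := by rw [h, hc.add_left _ _ _ h' h'']
  have sr (w' w'' : ι → ℤ) {v w : ι → ℤ} (h : w = w' + w'') (h' : w' ⬝ᵥ v = 0)
      (h'' : w'' ⬝ᵥ v = 0) : c v w = c v w' + c v w'' := by rw [h, hc.add_right _ _ _ h' h'']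
  have Dsucc {i j m : ι} (hij : e i j = 0) (hji : e j i = 0) (him : e i m = 0) (hmi : e m i = 0)
      (hjm : e j m = 0) (hmj : e m j = 0) (a : ℤ) :
      D j m (a + 1) = D j i 1 + D i m 1 + D j m a := by
    have e1 : c ((a + 1) • e j - e m) (e j + (a + 1) • e m + (1 : ℤ) • e i) = D j m (a + 1) := by
      rw [sr _ _ rfl, hr, add_zero] <;>
      simp only [add_dotProduct, sub_dotProduct, smul_dotProduct, dr, Pi.add_apply,
        Pi.sub_apply, Pi.smul_apply, smul_eq_mul, es, hij, him, hjm, hji, hmi, hmj] <;> ring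
    have e2 : c ((1 : ℤ) • e j - e i) (e j + (a + 1) • e m + (1 : ℤ) • e i) = D j i 1 := by
      rw [sr (e j + (1 : ℤ) • e i) ((a + 1) • e m) (by module), hr, add_zero] <;>
      simp only [add_dotProduct, sub_dotProduct, smul_dotProduct, dr, Pi.add_apply,
        Pi.sub_apply, Pi.smul_apply, smul_eq_mul, es, hij, him, hjm, hji, hmi, hmj] <;> ring
    have e3 : c (a • e j + e i - e m) (e j + a • e m) = D j m a := by
      rw [sl (a • e j - e m) ((1 : ℤ) • e i) (by module), hl, add_zero] <;>
      simp only [add_dotProduct, sub_dotProduct, smul_dotProduct, dr, Pi.add_apply,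
        Pi.sub_apply, Pi.smul_apply, smul_eq_mul, es, hij, him, hjm, hji, hmi, hmj] <;> ring
    have e4 : c (a • e j + e i - e m) (e i + (1 : ℤ) • e m) = D i m 1 := by
      rw [sl ((1 : ℤ) • e i - e m) (a • e j) (by module), hl, add_zero] <;>
      simp only [add_dotProduct, sub_dotProduct, smul_dotProduct, dr, Pi.add_apply,
        Pi.sub_apply, Pi.smul_apply, smul_eq_mul, es, hij, him, hjm, hji, hmi, hmj] <;> ring
    rw [← e1, sl ((1 : ℤ) • e j - e i) (a • e j + e i - e m) (by module), e2,
      sr (e j + a • e m) (e i + (1 : ℤ) • e m) (by module), e3, e4]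
    · abel
    all_goals simp only [add_dotProduct, sub_dotProduct, smul_dotProduct, dr, Pi.add_apply,
        Pi.sub_apply, Pi.smul_apply, smul_eq_mul, es, hij, him, hjm, hji, hmi, hmj] <;> ring
  have Dneg {i j : ι} (hij : e i j = 0) (hji : e j i = 0) : D i j 1 = -D j i 1 := by
    have := hc.smul_left (-1) ((1 : ℤ) • e j - e i) (e j + (1 : ℤ) • e i) (by
      simp only [add_dotProduct, smul_dotProduct, dr, Pi.sub_apply, Pi.smul_apply, smul_eq_mul, es,
        hij, hji]
      ring)
    rw [neg_one_smul, neg_one_smul] at this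
    rw [← this]
    change c _ _ = c _ _
    congr 1 <;> module
  have Do {i : ι} (hi : i ≠ o) : D i o 1 = 0 := by
    simpa only [D, one_smul] using hD i hi
  have D1 {i j : ι} (hij : i ≠ j) : D i j 1 = 0 := by
    by_cases hj : j = o
    · subst hj; exact Do hij
    by_cases hi : i = o
    · subst hi; rw [Dneg (en hij) (en hij.symm), Do hij.symm, neg_zero]
    · have := Dsucc (i := o) (j := i) (m := j) (en (Ne.symm hi)) (en hi) (en (Ne.symm hj)) (en hj)
        (en hij) (en hij.symm) 0
      rwa [zero_add, D0 hij, Do hi, Dneg (en (Ne.symm hj)) (en hj), Do hj, neg_zero, add_zero,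
        add_zero] at this
  have Da {i j : ι} (hij : i ≠ j) (a : ℤ) : D i j a = 0 := by
    obtain ⟨m, hmi, hmj⟩ := exists_ne_ne hι i j
    have step (b : ℤ) : D i j (b + 1) = D i j b := by
      rw [Dsucc (i := m) (en hmi) (en hmi.symm) (en hmj) (en hmj.symm) (en hij) (en hij.symm),
        D1 hmi.symm, D1 hmj, add_zero, zero_add]
    induction a with
    | zero => exact D0 hij
    | succ b ih => rw [step, ih]
    | pred b ih => rw [← step, sub_add_cancel, ih]
  have F {i j m : ι} (ij : i ≠ j) (mi : m ≠ i) (mj : m ≠ j) (hij : e i j = 0) (hji : e j i = 0)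
      (him : e i m = 0) (hmi : e m i = 0) (hjm : e j m = 0) (hmj : e m j = 0) (a b : ℤ) :
      c (a • e j - b • e i) (a • e i + b • e j) = 0 := by
    have e1 : c (a • e j - b • e i) (a • e i + b • e j + (a * b) • e m) =
        c (a • e j - b • e i) (a • e i + b • e j) := by
      rw [sr _ _ rfl, hr, add_zero] <;>
      simp only [add_dotProduct, sub_dotProduct, smul_dotProduct, dr, Pi.add_apply,
        Pi.sub_apply, Pi.smul_apply, smul_eq_mul, es, hij, him, hjm, hji, hmi, hmj] <;> ring
    have e2 : c (a • e j - e m) (a • e i + b • e j + (a * b) • e m) = 0 := by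
      rw [sr (b • (e j + a • e m)) (a • e i) (by module), hr, add_zero, hc.smul_right]
      · exact (congrArg (b • ·) (Da mj.symm a)).trans (smul_zero b)
      all_goals simp only [add_dotProduct, sub_dotProduct, smul_dotProduct, dr, Pi.add_apply,
        Pi.sub_apply, Pi.smul_apply, smul_eq_mul, es, hij, him, hjm, hji, hmi, hmj] <;> ring
    have e3 : c (e m - b • e i) (a • e i + b • e j + (a * b) • e m) = 0 := by
      have he : e m - b • e i = (-1 : ℤ) • (b • e i - e m) := by module
      rw [he, sr (a • (e i + b • e m)) (b • e j) (by module), hr, add_zero, hc.smul_right,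
        hc.smul_left]
      · exact (congrArg (fun x => a • (-1 : ℤ) • x) (Da mi.symm b)).trans (by simp)
      all_goals simp only [add_dotProduct, sub_dotProduct, smul_dotProduct, dr, Pi.add_apply,
        Pi.sub_apply, Pi.smul_apply, smul_eq_mul, es, hij, him, hjm, hji, hmi, hmj] <;> ring
    rw [← e1, sl (a • e j - e m) (e m - b • e i) (by module), e2, e3, add_zero] <;>
    simp only [add_dotProduct, sub_dotProduct, smul_dotProduct, dr, Pi.add_apply,
      Pi.sub_apply, Pi.smul_apply, smul_eq_mul, es, hij, him, hjm, hji, hmi, hmj] <;> ring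
  have orth (i j : ι) : w ⬝ᵥ (w i • e j - w j • e i) = 0 := by
    rw [dotProduct_comm]
    simp only [sub_dotProduct, smul_dotProduct, dr, smul_eq_mul]
    ring
  have G (i j : ι) : c (w i • e j - w j • e i) w = 0 := by
    obtain rfl | ij := eq_or_ne i j
    · rw [sub_self, hc.zero_left]
    obtain ⟨m, mi, mj⟩ := exists_ne_ne hι i j
    have hij := en ij
    have hji := en ij.symm
    have r (k : ι) (hk : k = i ∨ k = j) : (w - (w i • e i + w j • e j)) k = 0 := by
      rcases hk with rfl | rfl <;>
        simp only [Pi.add_apply, Pi.sub_apply, Pi.smul_apply, smul_eq_mul, es, hij, hji] <;> ring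
    have hrest (k : ι) (hk : k = i ∨ k = j) (z : ℤ) :
        (w - (w i • e i + w j • e j)) ⬝ᵥ (z • e k) = 0 := by
      rw [dotProduct_smul, dotProduct_comm, dr, r k hk, smul_zero]
    have hmain : (w i • e i + w j • e j) ⬝ᵥ (w i • e j - w j • e i) = 0 := by
      simp only [add_dotProduct, smul_dotProduct, dr, Pi.sub_apply, Pi.smul_apply, smul_eq_mul, es,
        hij, hji]
      ring
    have hj := hrest j (Or.inr rfl) (w i)
    have hi := hrest i (Or.inl rfl) (-w j)
    rw [sr (w i • e i + w j • e j) (w - (w i • e i + w j • e j)) (by abel) hmain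
      (by rw [sub_dotProduct, orth, hmain, sub_zero]),
      F ij mi mj hij hji (en mi.symm) (en mi) (en mj.symm) (en mj), zero_add,
      sub_eq_add_neg (w i • e j), ← neg_smul, sl _ _ rfl hj hi, hl _ _ _ (r j (Or.inr rfl)),
      hl _ _ _ (r i (Or.inl rfl)),
      add_zero]
  have hsum : v = ∑ p : ι × ι, (u p.1 * v p.2) • (w p.1 • e p.2 - w p.2 • e p.1) := by
    ext k
    have h1 : ∑ i, ∑ j, u i * v j * (w i * e j k) = v k := by
      rw [← mul_one (v k), ← hu, dotProduct, Finset.mul_sum]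
      refine Finset.sum_congr rfl fun i _ => ?_
      rw [Finset.sum_eq_single k, es]
      · ring
      · intro j _ hj; rw [en hj]; ring
      · simp
    have h2 : ∑ i, ∑ j, u i * v j * (w j * e i k) = 0 := by
      rw [Finset.sum_eq_single k, ← mul_zero (u k), ← hv, dotProduct, Finset.mul_sum]
      · refine Finset.sum_congr rfl fun j _ => ?_
        rw [es]; ring
      · intro i _ hi; simp [en hi]
      · simp
    simp only [Finset.sum_apply, Pi.smul_apply, Pi.sub_apply, smul_eq_mul, mul_sub]
    rw [Finset.sum_sub_distrib, Fintype.sum_prod_type, Fintype.sum_prod_type, h1, h2, sub_zero]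
  rw [hsum, hc.sum_left]
  · refine Finset.sum_eq_zero fun p _ => ?_
    rw [hc.smul_left _ _ _ (orth _ _), G, smul_zero]
  · intro p
    rw [dotProduct_smul, orth, smul_zero]

end OrthAdditive

end Orthogonal

end SLElem

namespace SLElem

open Matrix Matrix.SpecialLinearGroup

section Congruence

variable {ι : Type*} [Fintype ι] [DecidableEq ι] {R : Type*} [CommRing R] {τ : R} {ρ : R →+* ℤ}

lemma mem_ker_map_iff {S : Type*} [CommRing S] {ρ : R →+* S} (hρ : ∀ x, ρ x = 0 ↔ τ ∣ x)
    (X : SpecialLinearGroup ι R) :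
    X ∈ (SpecialLinearGroup.map ρ).ker ↔ ∃ Y : Matrix ι ι R, X.1 = 1 + τ • Y := by
  rw [MonoidHom.mem_ker]
  constructor
  · intro h
    have (a b : ι) : τ ∣ X.1 a b - (1 : Matrix ι ι R) a b := by
      rw [← hρ, map_sub, sub_eq_zero]
      refine (congrFun (congrFun (congrArg Subtype.val h) a) b).trans ?_
      exact (congrFun (congrFun (map_one ρ.mapMatrix) a) b).symm
    choose Y hY using this
    refine ⟨Matrix.of Y, ?_⟩
    ext1 a b
    exact sub_eq_iff_eq_add'.1 (hY a b)
  · rintro ⟨Y, hY⟩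
    refine Subtype.ext ?_
    change ρ.mapMatrix X.1 = 1
    rw [hY, map_add, map_one]
    convert add_zero _
    ext1 a b
    exact (hρ _).2 (dvd_mul_right τ (Y a b))

lemma eq_of_one_add_smul_eq {ι R : Type*} [DecidableEq ι] [CommRing R] {τ : R}
    (hτ : IsLeftRegular τ) {Y Z : Matrix ι ι R} (h : 1 + τ • Y = 1 + τ • Z) : Y = Z := by
  have := add_left_cancel h
  ext1 a b
  exact hτ (congrFun (congrFun this a) b)

/-- The leading coefficient `Y mod τ` of `X = 1 + τ Y`, as a homomorphism. -/
lemma exists_leading (hρ : ∀ x, ρ x = 0 ↔ τ ∣ x) (hτ : IsLeftRegular τ) :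
    ∃ f : (SpecialLinearGroup.map (n := ι) ρ).ker →* Multiplicative (Matrix ι ι ℤ),
      ∀ X Y, X.1.1 = 1 + τ • Y → f X = Multiplicative.ofAdd (ρ.mapMatrix Y) := by
  choose Y hY using fun X : (SpecialLinearGroup.map (n := ι) ρ).ker => (mem_ker_map_iff hρ X.1).1 X.2
  have hY' (X : (SpecialLinearGroup.map (n := ι) ρ).ker) (Z) (h : X.1.1 = 1 + τ • Z) : Y X = Z :=
    eq_of_one_add_smul_eq hτ ((hY X).symm.trans h)
  have hρτ : ρ τ = 0 := (hρ τ).2 dvd_rfl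
  refine ⟨MonoidHom.mk' (fun X => Multiplicative.ofAdd (ρ.mapMatrix (Y X))) fun X X' => ?_,
    fun X Z h => congrArg (fun Y => Multiplicative.ofAdd (ρ.mapMatrix Y)) (hY' X Z h)⟩
  rw [hY' (X * X') (Y X + Y X' + τ • (Y X * Y X')) ?_, ← ofAdd_add, ← map_add]
  · congr 1
    rw [map_add _ (_ + _)]
    convert add_zero _
    ext1 a b
    exact (hρ _).2 (dvd_mul_right _ _)
  · change X.1.1 * X'.1.1 = _
    rw [hY X, hY X']
    simp only [mul_add, add_mul, mul_one, one_mul, smul_mul_assoc, mul_smul_comm, smul_add]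
    abel

lemma trace_leading (hρ : ∀ x, ρ x = 0 ↔ τ ∣ x) (hτ : IsLeftRegular τ) {Y : Matrix ι ι R}
    (h : (1 + τ • Y).det = 1) : (ρ.mapMatrix Y).trace = 0 := by
  have hρτ : ρ τ = 0 := (hρ τ).2 dvd_rfl
  rw [det_one_add_smul, add_assoc, add_eq_left] at h
  have h2 : Y.trace + Polynomial.eval τ (1 + (Polynomial.X : Polynomial R) •
      Y.map ⇑Polynomial.C).det.divX.divX * τ = 0 :=
    hτ (by linear_combination h)
  have h3 := congrArg ρ h2
  rw [map_add, map_mul, hρτ, mul_zero, add_zero, map_zero] at h3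
  rw [← h3, trace, trace, map_sum]
  rfl

/-- The transvection `1 + v wᵀ` attached to an orthogonal pair. -/
def rankOne (v w : ι → R) (h : w ⬝ᵥ v = 0) : SpecialLinearGroup ι R :=
  ⟨1 + vecMulVec v w, by
    rw [vecMulVec_eq Unit, det_one_add_replicateCol_mul_replicateRow, h, add_zero]⟩

lemma transvection_eq_rankOne {i j : ι} (h : i ≠ j) (a : R) : transvection h a =
    rankOne (Pi.single i a) (Pi.single j 1) (by simp [h]) := by
  refine Subtype.ext ?_
  rw [transvection_coe]
  change _ = 1 + vecMulVec _ _
  rw [vecMulVec_single_single, mul_one]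

lemma conj_rankOne (N : SpecialLinearGroup ι R) (v w : ι → R) (h : w ⬝ᵥ v = 0) :
    N * rankOne v w h * N⁻¹ = rankOne (N.1 *ᵥ v) (w ᵥ* (N⁻¹).1) (by
      rw [dotProduct_mulVec, vecMul_vecMul, val_inv_mul_val, vecMul_one, h]) := by
  refine Subtype.ext ?_
  change N.1 * (1 + vecMulVec v w) * (N⁻¹).1 = 1 + vecMulVec _ _
  rw [mul_add, mul_one, add_mul, val_mul_val_inv, mul_vecMulVec, vecMulVec_mul]

lemma transvection_mul_transvection_comm {i m j : ι} (him : i ≠ m) (hmj : m ≠ j) (hij : i ≠ j)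
    (a b : R) :
    transvection him a * transvection hmj b =
      transvection hij (a * b) * (transvection hmj b * transvection him a) := by
  refine Subtype.ext ?_
  change (1 + single i m a) * (1 + single m j b) =
    (1 + single i j (a * b)) * ((1 + single m j b) * (1 + single i m a))
  simp only [mul_add, add_mul, mul_one, one_mul, single_mul_single_same,
    single_mul_single_of_ne _ _ _ _ hij.symm, single_mul_single_of_ne _ _ _ _ hmj.symm, add_zero]
  abel

/-- The congruence kernel is generated by the integral conjugates of its transvections. -/
theorem ker_le_of_conj_mem (hρ : ∀ x, ρ x = 0 ↔ τ ∣ x)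
    (hel : ∀ M : SpecialLinearGroup ι R, M ∈ elem R (Finset.univ : Finset ι))
    (H : Subgroup (SpecialLinearGroup ι R))
    (hH : ∀ (N : SpecialLinearGroup ι ℤ) (i j : ι) (hij : i ≠ j) (y : R),
      SpecialLinearGroup.map (Int.castRingHom R) N * transvection hij (τ * y) *
        (SpecialLinearGroup.map (Int.castRingHom R) N)⁻¹ ∈ H)
    (hHK : H ≤ (SpecialLinearGroup.map ρ).ker) :
    (SpecialLinearGroup.map ρ).ker ≤ H := by
  have hρc : ρ.comp (Int.castRingHom R) = RingHom.id ℤ := RingHom.ext_int _ _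
  have key (M : SpecialLinearGroup ι R) (hM : M ∈ elem R (Finset.univ : Finset ι)) :
      ∃ k ∈ H, ∃ N : SpecialLinearGroup ι ℤ,
        M = k * SpecialLinearGroup.map (Int.castRingHom R) N := by
    have step (M : SpecialLinearGroup ι R) (i j : ι) (hij : i ≠ j) (x : R)
        (h : ∃ k ∈ H, ∃ N : SpecialLinearGroup ι ℤ,
          M = k * SpecialLinearGroup.map (Int.castRingHom R) N) :
        ∃ k ∈ H, ∃ N : SpecialLinearGroup ι ℤ,
          M * transvection hij x = k * SpecialLinearGroup.map (Int.castRingHom R) N := by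
      obtain ⟨k, hk, N, rfl⟩ := h
      obtain ⟨y, hy⟩ : τ ∣ x - (ρ x : R) := by
        rw [← hρ, map_sub, map_intCast, Int.cast_id, sub_self]
      refine ⟨_, mul_mem hk (hH N i j hij y), N * transvection hij (ρ x), ?_⟩
      have : transvection hij x = transvection hij (τ * y) *
          SpecialLinearGroup.map (Int.castRingHom R) (transvection hij (ρ x)) := by
        rw [map_transvection]
        refine Subtype.ext ?_
        change Matrix.transvection i j x = Matrix.transvection i j _ * Matrix.transvection i j _
        rw [transvection_mul_transvection_same _ _ hij, ← hy]
        simp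
      rw [map_mul, this]
      group
    induction hM using Subgroup.closure_induction_right with
    | one => exact ⟨1, one_mem _, 1, by rw [map_one, one_mul]⟩
    | mul_right x _ y hy ih =>
      obtain ⟨i, j, hij, c, -, -, rfl⟩ := hy
      exact step _ _ _ _ _ ih
    | mul_inv_cancel x _ y hy ih =>
      obtain ⟨i, j, hij, c, -, -, rfl⟩ := hy
      have : (transvection hij c)⁻¹ = transvection hij (-c) := by
        rw [inv_eq_iff_mul_eq_one]
        refine Subtype.ext ?_
        change Matrix.transvection i j _ * Matrix.transvection i j _ = 1
        rw [transvection_mul_transvection_same _ _ hij, add_neg_cancel, transvection_zero]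
      rw [this]
      exact step _ _ _ _ _ ih
  intro X hX
  obtain ⟨k, hk, N, rfl⟩ := key X (hel X)
  have hN : N = 1 := by
    have h1 : SpecialLinearGroup.map ρ (k * SpecialLinearGroup.map (Int.castRingHom R) N) = 1 := hX
    have h2 : SpecialLinearGroup.map ρ k = 1 := hHK hk
    rw [map_mul, h2, one_mul] at h1
    rw [← h1]
    refine Subtype.ext ?_
    ext1 a b
    exact (RingHom.congr_fun hρc (N.1 a b)).symm
  rw [hN, map_one, mul_one]
  exact hk

end Congruence

end SLElem

namespace SLElem

open Matrix Matrix.SpecialLinearGroup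

lemma mulVec_single_apply {ι S : Type*} [Fintype ι] [DecidableEq ι] [CommRing S]
    (M : Matrix ι ι S) (i : ι) (x : S) (a : ι) : (M *ᵥ Pi.single i x) a = M a i * x := by
  simp

section IntRankOne

variable {ι : Type*} [Fintype ι] [DecidableEq ι] {R : Type*} [CommRing R] {ρ : R →+* ℤ}

/-- The transvection `1 + τ v wᵀ` attached to an orthogonal pair of integer vectors. -/
def intRankOne (τ : R) (v w : ι → ℤ) (h : w ⬝ᵥ v = 0) : SpecialLinearGroup ι R :=
  rankOne (τ • (Int.castRingHom R ∘ v)) (Int.castRingHom R ∘ w) (by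
    rw [dotProduct_smul, ← RingHom.map_dotProduct, h, map_zero, smul_zero])

lemma intRankOne_val (τ : R) (v w : ι → ℤ) (h : w ⬝ᵥ v = 0) :
    (intRankOne τ v w h).1 = 1 + τ • (Int.castRingHom R).mapMatrix (vecMulVec v w) := by
  change 1 + vecMulVec _ _ = _
  rw [smul_vecMulVec]
  congr 2
  ext1 a b
  exact (map_mul (Int.castRingHom R) (v a) (w b)).symm

lemma intRankOne_mul_left (τ : R) (v v' w : ι → ℤ) (h : w ⬝ᵥ v = 0) (h' : w ⬝ᵥ v' = 0) :
    intRankOne τ v w h * intRankOne τ v' w h' =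
      intRankOne τ (v + v') w (by rw [dotProduct_add, h, h', add_zero]) := by
  refine Subtype.ext ?_
  have e : τ • (Int.castRingHom R ∘ (v + v')) =
      τ • (Int.castRingHom R ∘ v) + τ • (Int.castRingHom R ∘ v') := by
    rw [← smul_add]
    congr 1
    ext1 i
    exact map_add (Int.castRingHom R) (v i) (v' i)
  change (1 + vecMulVec _ _) * (1 + vecMulVec _ _) = 1 + vecMulVec _ _
  rw [one_add_vecMulVec_mul, e, add_vecMulVec]
  rw [dotProduct_smul, ← RingHom.map_dotProduct, h', map_zero, smul_zero]

lemma intRankOne_mul_right (τ : R) (v w w' : ι → ℤ) (h : w ⬝ᵥ v = 0) (h' : w' ⬝ᵥ v = 0) :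
    intRankOne τ v w h * intRankOne τ v w' h' =
      intRankOne τ v (w + w') (by rw [add_dotProduct, h, h', add_zero]) := by
  refine Subtype.ext ?_
  have e : Int.castRingHom R ∘ (w + w') = Int.castRingHom R ∘ w + Int.castRingHom R ∘ w' := by
    ext1 i
    exact map_add (Int.castRingHom R) (w i) (w' i)
  change (1 + vecMulVec _ _) * (1 + vecMulVec _ _) = 1 + vecMulVec _ _
  rw [one_add_vecMulVec_mul, e, vecMulVec_add]
  rw [dotProduct_smul, ← RingHom.map_dotProduct, h, map_zero, smul_zero]

variable {τ : R}

lemma intRankOne_mem (hρ : ∀ x, ρ x = 0 ↔ τ ∣ x) (v w : ι → ℤ) (h : w ⬝ᵥ v = 0) :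
    intRankOne τ v w h ∈ (SpecialLinearGroup.map ρ).ker :=
  (mem_ker_map_iff hρ _).2 ⟨_, intRankOne_val τ v w h⟩

/-- The value of a homomorphism on the transvections `1 + τ v wᵀ`. -/
noncomputable def onRankOne {B : Type*} [AddCommGroup B] (hρ : ∀ x, ρ x = 0 ↔ τ ∣ x)
    (θ : (SpecialLinearGroup.map (n := ι) ρ).ker →* Multiplicative B) (v w : ι → ℤ) : B :=
  if h : w ⬝ᵥ v = 0 then (θ ⟨intRankOne τ v w h, intRankOne_mem hρ v w h⟩).toAdd else 0

variable {B : Type*} [AddCommGroup B] (hρ : ∀ x, ρ x = 0 ↔ τ ∣ x)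
  (θ : (SpecialLinearGroup.map (n := ι) ρ).ker →* Multiplicative B)

lemma onRankOne_of_orth {v w : ι → ℤ} (h : w ⬝ᵥ v = 0) : onRankOne hρ θ v w =
    (θ ⟨intRankOne τ v w h, intRankOne_mem hρ v w h⟩).toAdd :=
  dif_pos h

lemma orthAdditive_onRankOne : OrthAdditive (onRankOne hρ θ) where
  add_left v v' w h h' := by
    rw [onRankOne_of_orth hρ θ h, onRankOne_of_orth hρ θ h',
      onRankOne_of_orth hρ θ (by rw [dotProduct_add, h, h', add_zero]), ← toAdd_mul, ← map_mul]
    congr 2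
    exact Subtype.ext (intRankOne_mul_left τ v v' w h h').symm
  add_right v w w' h h' := by
    rw [onRankOne_of_orth hρ θ h, onRankOne_of_orth hρ θ h',
      onRankOne_of_orth hρ θ (by rw [add_dotProduct, h, h', add_zero]), ← toAdd_mul, ← map_mul]
    congr 2
    exact Subtype.ext (intRankOne_mul_right τ v w w' h h').symm

/-- A homomorphism from the congruence kernel to an abelian group is trivial as soon as it is
trivial on the transvections attached to `(e i, e j)` and `(e i - e o, e i + e o)`. -/
theorem hom_eq_one (hι : 3 ≤ Fintype.card ι)
    (hel : ∀ M : SpecialLinearGroup ι R, M ∈ elem R (Finset.univ : Finset ι))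
    (hE : ∀ i j, i ≠ j → onRankOne hρ θ (Pi.single i 1) (Pi.single j 1) = 0) (o : ι)
    (hD : ∀ i, i ≠ o →
      onRankOne hρ θ (Pi.single i 1 - Pi.single o 1) (Pi.single i 1 + Pi.single o 1) = 0)
    (X : (SpecialLinearGroup.map (n := ι) ρ).ker) : θ X = 1 := by
  suffices (SpecialLinearGroup.map ρ).ker ≤ θ.ker.map (SpecialLinearGroup.map ρ).ker.subtype by
    obtain ⟨Y, hY, e⟩ := this X.2
    rw [← Subtype.ext (a1 := Y) (a2 := X) e]
    exact hY
  refine ker_le_of_conj_mem hρ hel _ ?_ (Subgroup.map_subtype_le _)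
  intro N i j hij y
  set N' := SpecialLinearGroup.map (Int.castRingHom R) N with hN'
  have hker {i j : ι} (hij : i ≠ j) (y : R) :
      N' * transvection hij (τ * y) * N'⁻¹ ∈ (SpecialLinearGroup.map ρ).ker := by
    refine (inferInstance : (SpecialLinearGroup.map ρ).ker.Normal).conj_mem _ ?_ _
    refine (mem_ker_map_iff hρ _).2 ⟨single i j y, ?_⟩
    rw [transvection_coe, smul_single, smul_eq_mul]
  have hadd (a b : R) : transvection hij (a + b) = transvection hij a * transvection hij b := by
    refine Subtype.ext ?_
    change Matrix.transvection i j _ = Matrix.transvection i j _ * Matrix.transvection i j _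
    rw [transvection_mul_transvection_same _ _ hij]
  obtain ⟨z, hz⟩ : τ ∣ y - (ρ y : R) := by
    rw [← hρ, map_sub, map_intCast, Int.cast_id, sub_self]
  have hy : τ * y = τ * (ρ y : R) + τ * (τ * z) := by rw [← hz]; ring
  have hsplit : N' * transvection hij (τ * y) * N'⁻¹ =
      (N' * transvection hij (τ * (ρ y : R)) * N'⁻¹) *
        (N' * transvection hij (τ * (τ * z)) * N'⁻¹) := by
    rw [hy, hadd]; group
  rw [hsplit]
  refine mul_mem ⟨⟨_, hker hij _⟩, ?_, rfl⟩ ⟨⟨_, hker hij _⟩, ?_, rfl⟩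
  · have h0 : Pi.single j (1 : ℤ) ⬝ᵥ Pi.single i (ρ y) = 0 := by simp [hij]
    have h : (Pi.single j (1 : ℤ) ᵥ* (N⁻¹).1) ⬝ᵥ (N.1 *ᵥ Pi.single i (ρ y)) = 0 := by
      rw [dotProduct_mulVec, vecMul_vecMul, val_inv_mul_val, vecMul_one, h0]
    have e : N' * transvection hij (τ * (ρ y : R)) * N'⁻¹ = intRankOne τ _ _ h := by
      rw [transvection_eq_rankOne, conj_rankOne]
      have e1 : N'.1 *ᵥ Pi.single i (τ * (ρ y : R)) =
          τ • (Int.castRingHom R ∘ (N.1 *ᵥ Pi.single i (ρ y))) := by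
        ext1 a
        refine (mulVec_single_apply N'.1 i _ a).trans ?_
        refine Eq.trans ?_ (congrArg (fun t => τ * Int.castRingHom R t)
          (mulVec_single_apply N.1 i (ρ y) a).symm)
        change Int.castRingHom R (N.1 a i) * (τ * (ρ y : R)) = τ * Int.castRingHom R (N.1 a i * ρ y)
        rw [map_mul, mul_left_comm]
        rfl
      have e2 : Pi.single j (1 : R) ᵥ* (N'⁻¹).1 =
          Int.castRingHom R ∘ (Pi.single j 1 ᵥ* (N⁻¹).1) := by
        rw [single_one_vecMul, single_one_vecMul, hN', ← map_inv]
        rfl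
      refine Subtype.ext ?_
      change 1 + vecMulVec _ _ = 1 + vecMulVec _ _
      rw [e1, e2]
    have hz := (orthAdditive_onRankOne hρ θ).eq_zero_of_unimodular hι hE o hD h
      (u := N.1 *ᵥ Pi.single j 1) (by
        rw [dotProduct_comm, dotProduct_mulVec, vecMul_vecMul, val_inv_mul_val, vecMul_one]; simp)
    rw [onRankOne_of_orth hρ θ h] at hz
    exact (congrArg θ (Subtype.ext e)).trans hz
  · obtain ⟨m, him, hmj⟩ : ∃ m, i ≠ m ∧ m ≠ j :=
      let ⟨m, h1, h2⟩ := exists_ne_ne hι i j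
      ⟨m, h1.symm, h2⟩
    have e : (⟨_, hker him 1⟩ * ⟨_, hker hmj z⟩ : (SpecialLinearGroup.map (n := ι) ρ).ker) =
        ⟨_, hker hij (τ * z)⟩ * (⟨_, hker hmj z⟩ * ⟨_, hker him 1⟩) := by
      refine Subtype.ext ?_
      change (N' * _ * N'⁻¹) * (N' * _ * N'⁻¹) =
        (N' * _ * N'⁻¹) * ((N' * _ * N'⁻¹) * (N' * _ * N'⁻¹))
      have := transvection_mul_transvection_comm him hmj hij (τ * 1) (τ * z)
      rw [mul_one] at this ⊢
      calc _ = N' * (transvection him τ * transvection hmj (τ * z)) * N'⁻¹ := by group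
        _ = _ := by rw [this]; group
    have e' := congrArg θ e
    rw [map_mul, map_mul, map_mul, mul_comm (θ ⟨_, hker him 1⟩), right_eq_mul] at e'
    exact e'

end IntRankOne

end SLElem

namespace SLElem

open Matrix Matrix.SpecialLinearGroup

section Abelianization

variable {ι : Type*} [Fintype ι] [DecidableEq ι] {R : Type*} [CommRing R] {τ : R} {ρ : R →+* ℤ}

/-- If `SL R` is generated by transvections, the abelianization of the congruence kernel of
`ρ : R → ℤ`, with `ker ρ` generated by the regular element `τ`, is `sl(ℤ)`. -/
theorem exists_abelianization_equiv (hι : 3 ≤ Fintype.card ι) (hρ : ∀ x, ρ x = 0 ↔ τ ∣ x)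
    (hτ : IsLeftRegular τ)
    (hel : ∀ M : SpecialLinearGroup ι R, M ∈ elem R (Finset.univ : Finset ι)) :
    ∃ e : Abelianization (SpecialLinearGroup.map (n := ι) ρ).ker ≃*
        Multiplicative (LinearMap.ker (traceLinearMap ι ℤ ℤ)),
      ∀ X Y, X.1.1 = 1 + τ • Y → (e (Abelianization.of X)).toAdd.1 = ρ.mapMatrix Y := by
  obtain ⟨f, hf⟩ := exists_leading (ι := ι) hρ hτ
  let θ : (SpecialLinearGroup.map (n := ι) ρ).ker →*
      Multiplicative (Additive (Abelianization (SpecialLinearGroup.map (n := ι) ρ).ker)) :=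
    MonoidHom.mk' (fun X => Multiplicative.ofAdd (Additive.ofMul (Abelianization.of X)))
      fun X Y => congrArg (fun Z => Multiplicative.ofAdd (Additive.ofMul Z)) (map_mul _ X Y)
  let c := onRankOne hρ θ
  let lead : Additive (Abelianization (SpecialLinearGroup.map (n := ι) ρ).ker) →+ Matrix ι ι ℤ :=
    MonoidHom.toAdditiveLeft (Abelianization.lift f)
  have hlead {v w : ι → ℤ} (h : w ⬝ᵥ v = 0) : lead (c v w) = vecMulVec v w := by
    change lead (onRankOne hρ θ v w) = _
    rw [onRankOne_of_orth hρ θ h]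
    change (f _).toAdd = _
    rw [hf _ _ (intRankOne_val τ v w h), toAdd_ofAdd]
    ext1 a b
    change ρ (Int.castRingHom R _) = _
    simp
  have hcard : 0 < Fintype.card ι := by omega
  obtain ⟨o⟩ := Fintype.card_pos_iff.1 hcard
  let e (i : ι) : ι → ℤ := Pi.single i 1
  have he {i j : ι} (h : i ≠ j) : e j ⬝ᵥ e i = 0 := by simp [e, h]
  have hd (i : ι) : (e i + e o) ⬝ᵥ (e i - e o) = 0 := by
    obtain rfl | h := eq_or_ne i o
    · simp
    · simp [e, h]
  let g (i j : ι) : Additive (Abelianization (SpecialLinearGroup.map (n := ι) ρ).ker) :=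
    if i = j then (if i = o then 0 else
      c (e i - e o) (e i + e o) - c (e i) (e o) + c (e o) (e i)) else c (e i) (e j)
  have hg (i j : ι) : lead (g i j) = single i j 1 - if i = j then single o o 1 else 0 := by
    have hs (i j : ι) : vecMulVec (e i) (e j) = single i j 1 := by
      rw [vecMulVec_single_single, mul_one]
    by_cases hij : i = j
    · subst hij
      by_cases hi : i = o
      · simp [g, hi]
      · simp only [g, if_true, if_neg hi]
        rw [map_add, map_sub, hlead (hd i), hlead (he hi), hlead (he (Ne.symm hi)), sub_vecMulVec,
          vecMulVec_add, vecMulVec_add, hs, hs, hs, hs]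
        abel
    · simp only [g, if_neg hij]
      rw [hlead (he hij), hs, sub_zero]
  let ψ : Matrix ι ι ℤ →+ Additive (Abelianization (SpecialLinearGroup.map (n := ι) ρ).ker) :=
    AddMonoidHom.mk' (fun B => ∑ i, ∑ j, B i j • g i j) fun B B' => by
      simp only [Matrix.add_apply, add_smul, Finset.sum_add_distrib]
  have hψ1 (i j : ι) (z : ℤ) : ψ (single i j z) = z • g i j := by
    change ∑ a, ∑ b, single i j z a b • g a b = _
    rw [Finset.sum_eq_single i, Finset.sum_eq_single j, single_apply_same]
    · intro b _ hb; rw [single_apply_of_col_ne _ _ hb.symm, zero_smul]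
    · simp
    · intro a _ ha
      exact Finset.sum_eq_zero fun b _ => by rw [single_apply_of_row_ne ha.symm, zero_smul]
    · simp
  have hlψ (B : Matrix ι ι ℤ) : lead (ψ B) = B - single o o B.trace := by
    have h1 : lead (ψ B) = ∑ i, ∑ j, B i j • lead (g i j) := by
      change lead (∑ i, ∑ j, B i j • g i j) = _
      simp only [map_sum, map_zsmul]
    have h2 : single o o B.trace = ∑ i, ∑ j, B i j • (if i = j then single o o 1 else 0) := by
      simp only [smul_ite, smul_zero, Finset.sum_ite_eq, Finset.mem_univ, if_true, smul_single,
        smul_eq_mul, mul_one]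
      ext a b
      simp [trace, Matrix.sum_apply, single_apply, Finset.sum_ite_irrel]
    rw [h1, h2]
    conv_rhs => enter [1]; rw [matrix_eq_sum_single B]
    rw [← Finset.sum_sub_distrib]
    refine Finset.sum_congr rfl fun i _ => ?_
    rw [← Finset.sum_sub_distrib]
    refine Finset.sum_congr rfl fun j _ => ?_
    rw [hg, smul_sub, smul_single, smul_eq_mul, mul_one]
  have hψ : Function.Surjective ψ := by
    rw [← AddMonoidHom.range_eq_top, eq_top_iff]
    let q := QuotientAddGroup.mk' ψ.range
    let θ' : (SpecialLinearGroup.map (n := ι) ρ).ker →* Multiplicative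
      (Additive (Abelianization (SpecialLinearGroup.map (n := ι) ρ).ker) ⧸ ψ.range) :=
      (AddMonoidHom.toMultiplicative q).comp θ
    have hgq (i j : ι) : q (g i j) = 0 :=
      (QuotientAddGroup.eq_zero_iff _).2 ⟨single i j 1, by rw [hψ1, one_smul]⟩
    have hcq (v w : ι → ℤ) : onRankOne hρ θ' v w = q (c v w) := by
      change _ = q (onRankOne hρ θ v w)
      unfold onRankOne
      split_ifs
      · rfl
      · rw [map_zero]
    have hE (i j : ι) (h : i ≠ j) : q (c (e i) (e j)) = 0 := by
      have := hgq i j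
      simpa only [g, if_neg h] using this
    have htriv := hom_eq_one hρ θ' hι hel (fun i j h => by rw [hcq]; exact hE i j h) o
      (fun i h => by
        rw [hcq]
        have := hgq i i
        simp only [g, if_true, if_neg h] at this
        rwa [map_add, map_sub, hE i o h, hE o i h.symm, sub_zero, add_zero] at this)
    intro x _
    obtain ⟨X, hX⟩ : ∃ X, Abelianization.of X = x.toMul := QuotientGroup.mk_surjective x.toMul
    have : q x = 0 := by
      have h1 : q (Additive.ofMul (Abelianization.of X)) = 0 := htriv X
      rwa [hX] at h1
    exact (QuotientAddGroup.eq_zero_iff _).1 this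
  have htr (x : Abelianization (SpecialLinearGroup.map (n := ι) ρ).ker) :
      (lead (Additive.ofMul x)).trace = 0 := by
    obtain ⟨X, rfl⟩ := QuotientGroup.mk_surjective x
    obtain ⟨Y, hY⟩ := (mem_ker_map_iff hρ X.1).1 X.2
    change (f X).toAdd.trace = 0
    rw [hf X Y hY, toAdd_ofAdd]
    refine trace_leading hρ hτ (Y := Y) ?_
    rw [← hY]
    exact X.1.2
  let F : Abelianization (SpecialLinearGroup.map (n := ι) ρ).ker →*
      Multiplicative (LinearMap.ker (traceLinearMap ι ℤ ℤ)) :=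
    MonoidHom.mk' (fun x => Multiplicative.ofAdd ⟨lead (Additive.ofMul x), htr x⟩) fun x y =>
      congrArg Multiplicative.ofAdd (Subtype.ext (map_add lead (Additive.ofMul x) (Additive.ofMul y)))
  refine ⟨MulEquiv.ofBijective F ⟨?_, ?_⟩, fun X Y h => ?_⟩
  · rw [injective_iff_map_eq_one]
    intro x hx
    obtain ⟨B, hB⟩ := hψ (Additive.ofMul x)
    have h0 : lead (Additive.ofMul x) = 0 := congrArg (fun z => z.toAdd.1) hx
    have h1 : B = single o o B.trace := by
      rw [← hB, hlψ] at h0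
      exact sub_eq_zero.1 h0
    have h2 : ψ B = 0 := by
      rw [h1, hψ1]
      simp [g]
    exact hB.symm.trans h2
  · intro z
    refine ⟨(ψ z.toAdd.1).toMul, congrArg Multiplicative.ofAdd (Subtype.ext ?_)⟩
    have hz : z.toAdd.1.trace = 0 := z.toAdd.2
    change lead (ψ z.toAdd.1) = z.toAdd.1
    rw [hlψ, hz, single_zero, sub_zero]
  · change (f X).toAdd = _
    rw [hf X Y h, toAdd_ofAdd]

end Abelianization

end SLElem

namespace SLElem

open Matrix Matrix.SpecialLinearGroup

section Conclusion

theorem isLeftRegular_of_ne_zero {R : Type*} [CommRing R] [IsDomain R] {x : R} (hx : x ≠ 0) :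
    IsLeftRegular x := fun _ _ h => mul_left_cancel₀ hx h

open Polynomial in
theorem exists_abelianization_equiv_poly {ι : Type*} [Fintype ι] [DecidableEq ι]
    (hι : 3 ≤ Fintype.card ι) :
    ∃ e : Abelianization (SpecialLinearGroup.map (n := ι) (evalRingHom (0 : ℤ))).ker ≃*
        Multiplicative (LinearMap.ker (traceLinearMap ι ℤ ℤ)),
      ∀ X, (e (Abelianization.of X)).toAdd.1 =
        fun a b => (X.1.1 a b - (1 : Matrix ι ι ℤ[X]) a b).coeff 1 := by
  have hρ (x : ℤ[X]) : evalRingHom (0 : ℤ) x = 0 ↔ X ∣ x := by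
    rw [coe_evalRingHom, ← coeff_zero_eq_eval_zero, X_dvd_iff]
  obtain ⟨e, he⟩ := exists_abelianization_equiv hι hρ (isLeftRegular_of_ne_zero X_ne_zero)
    (mem_elem_intPolynomial hι)
  refine ⟨e, fun M => ?_⟩
  obtain ⟨Y, hY⟩ := (mem_ker_map_iff hρ M.1).1 M.2
  rw [he M Y hY, hY]
  ext a b
  change eval 0 (Y a b) = ((1 : Matrix ι ι ℤ[X]) a b + X * Y a b - (1 : Matrix ι ι ℤ[X]) a b).coeff 1
  rw [add_sub_cancel_left, coeff_X_mul, coeff_zero_eq_eval_zero]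

open LaurentPolynomial

/-- Evaluation of integral Laurent polynomials at `1`. -/
noncomputable def laurentEvalOne : ℤ[T;T⁻¹] →+* ℤ := LaurentPolynomial.eval₂ (RingHom.id ℤ) 1

theorem laurentEvalOne_C (z : ℤ) : laurentEvalOne (C z) = z := by
  simp [laurentEvalOne]

theorem laurentEvalOne_T (k : ℤ) : laurentEvalOne (T k) = 1 := by
  simp [laurentEvalOne]

theorem laurentEvalOne_eq_zero_iff (x : ℤ[T;T⁻¹]) : laurentEvalOne x = 0 ↔ T 1 - 1 ∣ x := by
  constructor
  · intro h
    let q := Ideal.Quotient.mk (Ideal.span {(T 1 - 1 : ℤ[T;T⁻¹])})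
    have hq : q = (q.comp C).comp laurentEvalOne := by
      apply IsLocalization.ringHom_ext (Submonoid.powers (Polynomial.X : Polynomial ℤ))
      apply Polynomial.ringHom_ext'
      · exact RingHom.ext_int _ _
      · change q (Polynomial.toLaurent Polynomial.X) =
          q (C (laurentEvalOne (Polynomial.toLaurent Polynomial.X)))
        rw [Polynomial.toLaurent_X, laurentEvalOne_T, map_one]
        exact (Ideal.Quotient.mk_eq_mk_iff_sub_mem _ _).2 (Ideal.mem_span_singleton_self _)
    have h0 : q x = 0 := by
      rw [hq]
      change q (C (laurentEvalOne x)) = 0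
      rw [h, map_zero, map_zero]
    exact Ideal.mem_span_singleton.1 (Ideal.Quotient.eq_zero_iff_mem.1 h0)
  · rintro ⟨y, rfl⟩
    rw [map_mul, map_sub, laurentEvalOne_T, map_one, sub_self, zero_mul]

theorem T_one_sub_one_ne_zero : (T 1 - 1 : ℤ[T;T⁻¹]) ≠ 0 := by
  intro h
  have h2 := congrArg (LaurentPolynomial.eval₂ (RingHom.id ℤ) (-1)) h
  rw [map_sub, map_one, map_zero, LaurentPolynomial.eval₂_T] at h2
  norm_num at h2

theorem ker_map_mk_eq {ι : Type*} [Fintype ι] [DecidableEq ι] :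
    (SpecialLinearGroup.map (n := ι)
      (Ideal.Quotient.mk (Ideal.span {(T 1 - 1 : ℤ[T;T⁻¹])}))).ker =
      (SpecialLinearGroup.map laurentEvalOne).ker := by
  ext M
  refine (mem_ker_map_iff (τ := T 1 - 1) (fun x => ?_) M).trans
    (mem_ker_map_iff laurentEvalOne_eq_zero_iff M).symm
  rw [Ideal.Quotient.eq_zero_iff_mem, Ideal.mem_span_singleton]

theorem exists_abelianization_equiv_laurent {ι : Type*} [Fintype ι] [DecidableEq ι]
    (hι : 3 ≤ Fintype.card ι) :
    ∃ e : Abelianization (SpecialLinearGroup.map (n := ι)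
        (Ideal.Quotient.mk (Ideal.span {(T 1 - 1 : ℤ[T;T⁻¹])}))).ker ≃*
        Multiplicative (LinearMap.ker (traceLinearMap ι ℤ ℤ)),
      ∀ X (A : Matrix ι ι ℤ),
        (∀ a b, (T 1 - 1 : ℤ[T;T⁻¹]) ^ 2 ∣
          X.1.1 a b - (1 : Matrix ι ι ℤ[T;T⁻¹]) a b - (T 1 - 1) * C (A a b)) →
        (e (Abelianization.of X)).toAdd.1 = A := by
  rw [ker_map_mk_eq]
  have hτ := isLeftRegular_of_ne_zero T_one_sub_one_ne_zero
  obtain ⟨e, he⟩ := exists_abelianization_equiv hι laurentEvalOne_eq_zero_iff hτ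
    (mem_elem_intLaurent hι)
  refine ⟨e, fun M A hA => ?_⟩
  obtain ⟨Y, hY⟩ := (mem_ker_map_iff laurentEvalOne_eq_zero_iff M.1).1 M.2
  rw [he M Y hY]
  ext1 a b
  change laurentEvalOne (Y a b) = A a b
  obtain ⟨z, hz⟩ := hA a b
  have h1 : M.1.1 a b = (1 : Matrix ι ι ℤ[T;T⁻¹]) a b + (T 1 - 1) * Y a b := by rw [hY]; rfl
  have h2 : Y a b - C (A a b) = (T 1 - 1) * z := hτ <| by
    change (T 1 - 1) * _ = (T 1 - 1) * _
    linear_combination hz - h1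
  have h3 := (laurentEvalOne_eq_zero_iff _).2 ⟨z, h2⟩
  rwa [map_sub, laurentEvalOne_C, sub_eq_zero] at h3

theorem nonempty_ker_trace_addEquiv (n : ℕ) (hn : n ≠ 0) :
    Nonempty (LinearMap.ker (traceLinearMap (Fin n) ℤ ℤ) ≃+ (Fin (n ^ 2 - 1) → ℤ)) := by
  have : NeZero n := ⟨hn⟩
  have hs : Function.Surjective (traceLinearMap (Fin n) ℤ ℤ) := fun z =>
    ⟨single 0 0 z, by simp⟩
  have h := (LinearMap.ker (traceLinearMap (Fin n) ℤ ℤ)).finrank_quotient_add_finrank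
  rw [((traceLinearMap (Fin n) ℤ ℤ).quotKerEquivOfSurjective hs).finrank_eq,
    Module.finrank_self, Module.finrank_matrix, Module.finrank_self, Fintype.card_fin] at h
  have h' : Module.finrank ℤ (LinearMap.ker (traceLinearMap (Fin n) ℤ ℤ)) = n ^ 2 - 1 := by
    rw [sq]; omega
  exact ⟨(Module.finBasisOfFinrankEq ℤ _ h').equivFun.toAddEquiv⟩

end Conclusion

end SLElem

/-- For `n ≥ 3` and `R = ℤ[t]` or `ℤ[t,t⁻¹]`, `H_1(K(R),ℤ) ≅ sl_n(ℤ)`, free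
abelian of rank `n² - 1`; the isomorphism is induced by the lowest-order
coefficient of `X - I` (coefficient of `t`, resp. of `(t-1)`). -/
theorem stmt15 (n : ℕ) (hn : 3 ≤ n) :
    (∃ e : Abelianization ↥(Kpoly n) ≃* Multiplicative ↥(slZ n),
      ∀ X : ↥(Kpoly n),
        ((e (Abelianization.of X)).toAdd : Matrix (Fin n) (Fin n) ℤ) =
          fun a b => ((X.val.val a b -
            (1 : Matrix (Fin n) (Fin n) (Polynomial ℤ)) a b).coeff 1)) ∧
    (∃ e : Abelianization ↥(KLauKer n) ≃* Multiplicative ↥(slZ n),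
      ∀ (X : ↥(KLauKer n)) (A : Matrix (Fin n) (Fin n) ℤ),
        (∀ a b : Fin n,
          (LaurentPolynomial.T (1 : ℤ) - 1 : LaurentPolynomial ℤ) ^ 2 ∣
            (X.val.val a b - (1 : Matrix (Fin n) (Fin n) (LaurentPolynomial ℤ)) a b -
              (LaurentPolynomial.T (1 : ℤ) - 1) * LaurentPolynomial.C (A a b))) →
        ((e (Abelianization.of X)).toAdd : Matrix (Fin n) (Fin n) ℤ) = A) ∧
    Nonempty (↥(slZ n) ≃+ (Fin (n ^ 2 - 1) → ℤ)) := by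
  have hι : 3 ≤ Fintype.card (Fin n) := by rwa [Fintype.card_fin]
  exact ⟨SLElem.exists_abelianization_equiv_poly hι, SLElem.exists_abelianization_equiv_laurent hι,
    SLElem.nonempty_ker_trace_addEquiv n (by omega)⟩
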